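/- Let V be a faithful irreducible four-dimensional complex representation of the quasi-simple group Sp4(F3). Then the fifth symmetric power S⁵V (of dimension 56) is a direct sum of two irreducible representations of Sp4(F3), of dimensions 20 and 36. -/

import Mathlib

/-- The quasi-simple symplectic group `Sp₄(F₃)`. -/
abbrev Sp4F3 : Type := Matrix.symplecticGroup (Fin 2) (ZMod 3)

section SymmetricPower

variable (V : Type) [AddCommGroup V] [Module ℂ V]

/-- The `k`-th symmetric power `SᵏV`, realised (in characteristic zero) as the space of
homogeneous polynomial functions of degree `k` on the dual space `V∨`:  the span, inside the
space of all functions `V∨ → ℂ`, of the functions `φ ↦ φ(v₁)⋯φ(v_k)` with `v₁, …, v_k ∈ V`. -/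
noncomputable def symPow (k : ℕ) : Submodule ℂ (Module.Dual ℂ V → ℂ) :=
  Submodule.span ℂ {f | ∃ v : Fin k → V, f = fun φ => ∏ i, φ (v i)}

variable {V}

/-- The action of `g` induced on functions on `V∨` by a representation `ρ` on `V`; on `SᵏV`
this is the `k`-th symmetric power of `ρ`. -/
noncomputable def symAct (ρ : Representation ℂ Sp4F3 V) (g : Sp4F3)
    (f : Module.Dual ℂ V → ℂ) : Module.Dual ℂ V → ℂ :=
  fun φ => f (φ ∘ₗ ρ g)

/-- A subspace of functions on `V∨` is a subrepresentation if it is stable under the group. -/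
def IsSubrep (ρ : Representation ℂ Sp4F3 V)
    (W : Submodule ℂ (Module.Dual ℂ V → ℂ)) : Prop :=
  ∀ g : Sp4F3, ∀ f ∈ W, symAct ρ g f ∈ W

/-- A subrepresentation is irreducible if it has no proper nonzero subrepresentation. -/
def IsIrredSubrep (ρ : Representation ℂ Sp4F3 V)
    (W : Submodule ℂ (Module.Dual ℂ V → ℂ)) : Prop :=
  IsSubrep ρ W ∧ W ≠ ⊥ ∧
    ∀ U : Submodule ℂ (Module.Dual ℂ V → ℂ), U ≤ W → IsSubrep ρ U → U = ⊥ ∨ U = W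

end SymmetricPower

/-! ### Part 1: transvections in the symplectic group -/

abbrev M4 : Type := Matrix (Fin 2 ⊕ Fin 2) (Fin 2 ⊕ Fin 2) (ZMod 3)

/-- transvection matrix attached to a vector -/
def tvM (w : Fin 2 ⊕ Fin 2 → ZMod 3) : M4 :=
  1 - Matrix.vecMulVec w w * Matrix.J (Fin 2) (ZMod 3)

def xv : Fin 4 → Fin 2 → ZMod 3 := ![![1, 0], ![0, 1], ![1, 1], ![1, 2]]
def yv : Fin 4 → Fin 2 → ZMod 3 := ![![0, 1], ![1, 0], ![1, 2], ![1, 1]]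

def wT (i : Fin 4) : Fin 2 ⊕ Fin 2 → ZMod 3 := Sum.elim (xv i) 0
def wR (i : Fin 4) : Fin 2 ⊕ Fin 2 → ZMod 3 := Sum.elim 0 (yv i)

theorem tvM_wT_mem : ∀ i, tvM (wT i) ∈ Matrix.symplecticGroup (Fin 2) (ZMod 3) := by
  simp only [SymplecticGroup.mem_iff]; decide +kernel
theorem tvM_wR_mem : ∀ i, tvM (wR i) ∈ Matrix.symplecticGroup (Fin 2) (ZMod 3) := by
  simp only [SymplecticGroup.mem_iff]; decide +kernel

def gT (i : Fin 4) : Sp4F3 := ⟨tvM (wT i), tvM_wT_mem i⟩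
def gR (i : Fin 4) : Sp4F3 := ⟨tvM (wR i), tvM_wR_mem i⟩

def pM : Fin 3 → M4 := ![
  Matrix.fromBlocks !![0, 1; 1, 0] 0 0 !![0, 1; 1, 0],
  Matrix.fromBlocks !![1, 1; 0, 1] 0 0 !![1, 0; 2, 1],
  Matrix.fromBlocks !![1, 0; 0, 2] 0 0 !![1, 0; 0, 2]]

theorem pM_mem : ∀ i, pM i ∈ Matrix.symplecticGroup (Fin 2) (ZMod 3) := by
  simp only [SymplecticGroup.mem_iff]; decide +kernel

def gP (i : Fin 3) : Sp4F3 := ⟨pM i, pM_mem i⟩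

theorem gT_comm : ∀ i j, gT i * gT j = gT j * gT i := by
  simp only [Subtype.ext_iff]; decide +kernel
theorem gR_comm : ∀ i j, gR i * gR j = gR j * gR i := by
  simp only [Subtype.ext_iff]; decide +kernel
theorem gT_cube : ∀ i, gT i * gT i * gT i = 1 := by
  simp only [Subtype.ext_iff]; decide +kernel
theorem gT_prod : gT 0 * gT 1 * gT 2 * gT 3 = 1 := by
  simp only [Subtype.ext_iff]; decide +kernel
theorem gT_ne_one : gT 0 ≠ 1 := by
  simp only [ne_eq, Subtype.ext_iff]; decide +kernel
theorem gR_ne_gT : ∀ i j, gR i ≠ gT j := by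
  simp only [ne_eq, Subtype.ext_iff]; decide +kernel
theorem gRT_comm : ∀ i, gR i * gT i = gT i * gR i := by
  simp only [Subtype.ext_iff]; decide +kernel
theorem gRT_braid : ∀ i j, i ≠ j → gR i * gT j * gR i = gT j * gR i * gT j := by
  simp only [Subtype.ext_iff]; decide +kernel
theorem gP_zero : gP 0 * gT 0 = gT 1 * gP 0 ∧ gP 0 * gT 1 = gT 0 * gP 0 ∧
    gP 0 * gT 2 = gT 2 * gP 0 ∧ gP 0 * gT 3 = gT 3 * gP 0 := by
  simp only [Subtype.ext_iff]; decide +kernel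
theorem gP_one : gP 1 * gT 0 = gT 0 * gP 1 ∧ gP 1 * gT 1 = gT 2 * gP 1 ∧
    gP 1 * gT 2 = gT 3 * gP 1 ∧ gP 1 * gT 3 = gT 1 * gP 1 := by
  simp only [Subtype.ext_iff]; decide +kernel
theorem gP_two : gP 2 * gT 0 = gT 0 * gP 2 ∧ gP 2 * gT 1 = gT 1 * gP 2 ∧
    gP 2 * gT 2 = gT 3 * gP 2 ∧ gP 2 * gT 3 = gT 2 * gP 2 := by
  simp only [Subtype.ext_iff]; decide +kernel

theorem mul_tvM (g : Sp4F3) (w : Fin 2 ⊕ Fin 2 → ZMod 3) :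
    (g : M4) * tvM w = tvM ((g : M4).mulVec w) * (g : M4) := by
  have h : (g : M4).transpose * Matrix.J (Fin 2) (ZMod 3) * (g : M4) = Matrix.J (Fin 2) (ZMod 3) := by
    have := SymplecticGroup.mem_iff'.1 g.2
    exact this
  unfold tvM
  have h2 : Matrix.J (Fin 2) (ZMod 3) = (g : M4).transpose * Matrix.J (Fin 2) (ZMod 3) * (g : M4) := h.symm
  rw [mul_sub, sub_mul, mul_one, one_mul]
  congr 1
  rw [← mul_assoc, Matrix.mul_vecMulVec]
  conv_lhs => rw [h2]
  rw [← mul_assoc, ← mul_assoc, Matrix.vecMulVec_mul, Matrix.vecMul_transpose]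

theorem gT_diag : ∀ a b c : ZMod 3, (((gT 0)^(a.val) * (gT 1)^(b.val) * (gT 2)^(c.val) : Sp4F3) : M4) =
   Matrix.fromBlocks 1 !![a + c, c; c, b + c] 0 1 := by
  decide +kernel

theorem orbit_wR : ∀ x0 x1 y0 y1 : ZMod 3, (y0 ≠ 0 ∨ y1 ≠ 0) → ∃ i : Fin 4, ∃ a b c : ZMod 3,
    (((a + c) * yv i 0 + c * yv i 1 = x0 ∧ c * yv i 0 + (b+c) * yv i 1 = x1 ∧ yv i 0 = y0 ∧ yv i 1 = y1) ∨
    ((a + c) * yv i 0 + c * yv i 1 = -x0 ∧ c * yv i 0 + (b+c) * yv i 1 = -x1 ∧ yv i 0 = -y0 ∧ yv i 1 = -y1)) := by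
  decide +kernel

theorem tvM_neg (w : Fin 2 ⊕ Fin 2 → ZMod 3) : tvM (-w) = tvM w := by
  unfold tvM; rw [Matrix.neg_vecMulVec, Matrix.vecMulVec_neg, neg_neg]

theorem orbit_wT : ∀ x0 x1 : ZMod 3, (x0 ≠ 0 ∨ x1 ≠ 0) → ∃ i : Fin 4,
    ((xv i 0 = x0 ∧ xv i 1 = x1) ∨ (xv i 0 = -x0 ∧ xv i 1 = -x1)) := by
  decide +kernel

theorem tvM_congr {u w : Fin 2 ⊕ Fin 2 → ZMod 3} (h : u = w ∨ u = -w) : tvM w = tvM u := by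
  rcases h with rfl | rfl
  · rfl
  · rw [tvM_neg]

theorem class_cases (g : Sp4F3) : (∃ j, g * gT 0 = gT j * g) ∨
    ∃ i : Fin 4, ∃ a b c : ℕ,
      g * gT 0 * g⁻¹ = (gT 0 ^ a * gT 1 ^ b * gT 2 ^ c) * gR i * (gT 0 ^ a * gT 1 ^ b * gT 2 ^ c)⁻¹ := by
  have h1 := mul_tvM g (wT 0)
  set w := (g : M4).mulVec (wT 0) with hw
  have hw0 : w ≠ 0 := by
    intro h0
    have : ((g⁻¹ : Sp4F3) : M4).mulVec w = wT 0 := by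
      rw [hw, Matrix.mulVec_mulVec]
      have : ((g⁻¹ : Sp4F3) : M4) * (g : M4) = 1 := by
        have := congrArg Subtype.val (inv_mul_cancel g)
        exact this
      rw [this, Matrix.one_mulVec]
    rw [h0, Matrix.mulVec_zero] at this
    have h2 := congrFun this (Sum.inl 0)
    revert h2; decide
  by_cases hy : w (Sum.inr 0) ≠ 0 ∨ w (Sum.inr 1) ≠ 0
  · right
    obtain ⟨i, a, b, c, h⟩ := orbit_wR (w (Sum.inl 0)) (w (Sum.inl 1)) _ _ hy
    refine ⟨i, a.val, b.val, c.val, ?_⟩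
    set h0 : Sp4F3 := gT 0 ^ a.val * gT 1 ^ b.val * gT 2 ^ c.val with hh0
    have h3 := mul_tvM h0 (wR i)
    have h4 : tvM w = tvM ((h0 : M4).mulVec (wR i)) := by
      apply tvM_congr
      rw [hh0, gT_diag]
      rcases h with ⟨e1, e2, e3, e4⟩ | ⟨e1, e2, e3, e4⟩
      · left
        ext k
        rcases k with k | k <;> fin_cases k <;>
          simp [wR, Matrix.mulVec, dotProduct, Fin.sum_univ_two, e3, e4]
        · rw [← e3, ← e4]; exact e1
        · rw [← e3, ← e4]; exact e2
      · right
        ext k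
        rcases k with k | k <;> fin_cases k <;>
          simp [wR, Matrix.mulVec, dotProduct, Fin.sum_univ_two, e3, e4]
        · rw [← e1, e3, e4]; ring
        · rw [← e2, e3, e4]; ring
    rw [← h4] at h3
    -- both equal to the transvection
    have h5 : (g : M4) * tvM (wT 0) * ((g⁻¹ : Sp4F3) : M4) = tvM w := by
      rw [h1, mul_assoc]
      have : (g : M4) * ((g⁻¹ : Sp4F3) : M4) = 1 := congrArg Subtype.val (mul_inv_cancel g)
      rw [this, mul_one]
    have h6 : (h0 : M4) * tvM (wR i) * ((h0⁻¹ : Sp4F3) : M4) = tvM w := by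
      rw [h3, mul_assoc]
      have : (h0 : M4) * ((h0⁻¹ : Sp4F3) : M4) = 1 := congrArg Subtype.val (mul_inv_cancel h0)
      rw [this, mul_one]
    exact Subtype.ext (h5.trans h6.symm)
  · left
    push Not at hy
    have hx : w (Sum.inl 0) ≠ 0 ∨ w (Sum.inl 1) ≠ 0 := by
      by_contra hx
      push Not at hx
      apply hw0
      ext k
      rcases k with k | k <;> fin_cases k
      · exact hx.1
      · exact hx.2
      · exact hy.1
      · exact hy.2
    obtain ⟨j, h⟩ := orbit_wT _ _ hx
    refine ⟨j, Subtype.ext ?_⟩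
    have h4 : tvM w = tvM (wT j) := by
      apply tvM_congr
      rcases h with ⟨e1, e2⟩ | ⟨e1, e2⟩
      · left
        ext k
        rcases k with k | k <;> fin_cases k <;> simp [wT, e1, e2, hy]
      · right
        ext k
        rcases k with k | k <;> fin_cases k <;> simp [wT, e1, e2, hy]
    rw [h4] at h1
    exact h1

/-! ### Part 2: weights of the Siegel unipotent radical -/

section Weights

variable {V : Type} [AddCommGroup V] [Module ℂ V]

def Wt (ρ : Representation ℂ Sp4F3 V) (ω : ℂ) (K : Fin 4 → ZMod 3) : Prop :=
  ∃ v : V, v ≠ 0 ∧ ∀ i, ρ (gT i) v = ω ^ (K i).val • v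

theorem om_inj {ω : ℂ} (hω : ω ^ 2 + ω + 1 = 0) {a b : ZMod 3} (h : ω ^ a.val = ω ^ b.val) : a = b := by
  have h1 : ω ≠ 1 := by rintro rfl; norm_num at hω
  have h3 : ω ^ 3 = 1 := by linear_combination (ω - 1) * hω
  have hp : IsPrimitiveRoot ω 3 := by
    rw [IsPrimitiveRoot.iff_orderOf]
    exact orderOf_eq_prime h3 h1
  exact ZMod.val_injective 3 (hp.pow_inj (ZMod.val_lt a) (ZMod.val_lt b) h)

theorem wt_indep (ρ : Representation ℂ Sp4F3 V) {n : ℕ} (v : Fin n → V) (c : Fin n → Fin 4 → ℂ)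
    (hc : Function.Injective c) (hv : ∀ j, v j ≠ 0) (h : ∀ i j, ρ (gT i) (v j) = c j i • v j) :
    LinearIndependent ℂ v := by
  have h1 := Module.End.independent_iInf_maxGenEigenspace_of_forall_mapsTo
    (fun i : Fin 4 => (ρ (gT i) : Module.End ℂ V)) (by
      intro i j φ
      apply Module.End.mapsTo_maxGenEigenspace_of_comm
      change ρ (gT j) * ρ (gT i) = ρ (gT i) * ρ (gT j)
      rw [← map_mul, ← map_mul, gT_comm])
  have h2 := h1.comp hc
  refine h2.linearIndependent _ (fun j => ?_) hv
  simp only [Function.comp_apply, Submodule.mem_iInf]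
  intro i
  have : v j ∈ Module.End.eigenspace (ρ (gT i)) (c j i) := by
    rw [Module.End.mem_eigenspace_iff]; exact h i j
  exact Module.End.genEigenspace_le_maximal _ _ _ this

theorem five_wt (ρ : Representation ℂ Sp4F3 V) [FiniteDimensional ℂ V]
    (hdim : Module.finrank ℂ V = 4) {ω : ℂ} (hω : ω ^ 2 + ω + 1 = 0)
    (K : Fin 5 → Fin 4 → ZMod 3) (hK : Function.Injective K) (h : ∀ j, Wt ρ ω (K j)) : False := by
  choose v hv hv2 using h
  have := wt_indep ρ v (fun j i => ω ^ (K j i).val) (by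
    intro j j' hj
    apply hK
    ext i : 1
    exact om_inj hω (congrFun hj i)) hv (fun i j => hv2 j i)
  have := this.fintype_card_le_finrank
  rw [hdim] at this
  simp at this

theorem wt_perm (ρ : Representation ℂ Sp4F3 V) {ω : ℂ} (σ : Fin 4 → Fin 4) (p : Sp4F3)
    (hp : ∀ i, p * gT (σ i) = gT i * p) {K : Fin 4 → ZMod 3} (h : Wt ρ ω K) : Wt ρ ω (K ∘ σ) := by
  obtain ⟨v, hv, h⟩ := h
  refine ⟨ρ p v, ?_, fun i => ?_⟩
  · intro h0
    apply hv
    have : ρ p⁻¹ (ρ p v) = v := by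
      rw [← Module.End.mul_apply, ← map_mul, inv_mul_cancel, map_one]; rfl
    rw [← this, h0, map_zero]
  · rw [← Module.End.mul_apply, ← map_mul, ← hp, map_mul, Module.End.mul_apply, h, map_smul]
    rfl

theorem eig_split {ω : ℂ} (hω : ω ^ 2 + ω + 1 = 0) (S : Module.End ℂ V) (hS : S * S * S = 1)
    (v : V) (hv : v ≠ 0) : ∃ w : V, w ≠ 0 ∧ (∃ k : ZMod 3, S w = ω ^ k.val • w) ∧
      ∀ R : Module.End ℂ V, R * S = S * R → ∀ d : ℂ, R v = d • v → R w = d • w := by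
  have h3 : ω ^ 3 = 1 := by linear_combination (ω - 1) * hω
  have hS' : S (S (S v)) = v := by
    have := congrArg (fun f => f v) hS
    exact this
  have hmem : ∀ a b c : ℂ, ∀ R : Module.End ℂ V, R * S = S * R → ∀ d : ℂ, R v = d • v →
      R (a • v + b • S v + c • S (S v)) = d • (a • v + b • S v + c • S (S v)) := by
    intro a b c R hR d hd
    have e : ∀ u, R (S u) = S (R u) := fun u => congrArg (fun f => f u) hR
    simp only [map_add, map_smul, e, hd]
    module
  by_contra hcon
  push Not at hcon
  have key : ∀ a : ℂ, a ^ 3 = 1 → (∃ k : ZMod 3, a ^ 2 = ω ^ k.val) → (1:ℂ) • v + a • S v + (a^2) • S (S v) = 0 := by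
    intro a ha hk
    by_contra hne
    obtain ⟨k, hk⟩ := hk
    obtain ⟨R, h1, d, h2, h4⟩ := hcon _ hne ⟨k, by
      simp only [map_add, map_smul, hS', ← hk, smul_add, smul_smul]
      have : a ^ 2 * a = 1 := by rw [← ha]; ring
      rw [this, show a^2 * a^2 = a by linear_combination a * ha]
      module⟩
    exact h4 (hmem _ _ _ R h1 d h2)
  have k0 := key 1 (by norm_num) ⟨0, by simp⟩
  have k1 := key ω h3 ⟨2, by rfl⟩
  have k2 := key (ω^2) (by linear_combination (ω^3+1) * h3) ⟨1, by
    rw [show (1 : ZMod 3).val = 1 from rfl]; linear_combination ω * h3⟩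
  apply hv
  have hz : (3:ℂ) • v = 0 := by
    have : (3:ℂ) • v = ((1:ℂ) • v + (1:ℂ) • S v + ((1:ℂ)^2) • S (S v)) + ((1:ℂ) • v + ω • S v + (ω^2) • S (S v))
      + ((1:ℂ) • v + (ω^2) • S v + ((ω^2)^2) • S (S v)) := by
      have e2 : (ω^2)^2 = ω := by linear_combination ω * h3
      have e1 : ω^2 = -1 - ω := by linear_combination hω
      rw [e2, e1]; module
    rw [this, k0, k1, k2]; simp
  exact (smul_eq_zero.1 hz).resolve_left (by norm_num)

theorem exists_eig {X : Module.End ℂ V} (hX : X * X * X = 1) (hne : X ≠ 1) :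
    ∃ ω : ℂ, ω ^ 2 + ω + 1 = 0 ∧ ∃ z : V, z ≠ 0 ∧ X z = ω • z := by
  obtain ⟨ω, hω⟩ : ∃ ω : ℂ, ω ^ 2 + ω + 1 = 0 := by
    obtain ⟨ω, h⟩ := IsAlgClosed.exists_root (Polynomial.X ^ 2 + Polynomial.X + 1 : Polynomial ℂ)
      (by
        have : (Polynomial.X ^ 2 + Polynomial.X + 1 : Polynomial ℂ).degree = 2 := by compute_degree!
        rw [this]; norm_num)
    exact ⟨ω, by simpa using h⟩
  obtain ⟨u, hu⟩ : ∃ u, X u ≠ u := by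
    by_contra h
    push Not at h
    exact hne (LinearMap.ext h)
  have hX' : X (X (X u)) = u := congrArg (fun f => f u) hX
  set y := X u - u with hy
  have hy0 : y ≠ 0 := sub_ne_zero.2 hu
  have hyy : X (X y) = - X y - y := by
    simp only [hy, map_sub, hX']; abel
  by_cases hz : X y - ω ^ 2 • y = 0
  · refine ⟨ω ^ 2, by linear_combination (ω^2 - ω + 1) * hω, y, hy0, ?_⟩
    exact sub_eq_zero.1 hz
  · refine ⟨ω, hω, _, hz, ?_⟩
    rw [map_sub, map_smul, hyy]
    have e1 : ω^2 = -1 - ω := by linear_combination hω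
    rw [smul_sub, smul_smul, show ω * ω ^ 2 = 1 by linear_combination (ω - 1) * hω, e1]
    module

theorem exists_wt_basis (ρ : Representation ℂ Sp4F3 V) [FiniteDimensional ℂ V]
    (hfaithful : Function.Injective ρ) (hdim : Module.finrank ℂ V = 4) :
    ∃ ω : ℂ, ω ^ 2 + ω + 1 = 0 ∧ ∃ b : Fin 4 → V, LinearIndependent ℂ b ∧
      ∀ i j, ρ (gT i) (b j) = (if i = j then 1 else ω) • b j := by
  have hcube : ∀ i, ρ (gT i) * ρ (gT i) * ρ (gT i) = 1 := by
    intro i; rw [← map_mul, ← map_mul, gT_cube, map_one]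
  have hcomm : ∀ i j, ρ (gT i) * ρ (gT j) = ρ (gT j) * ρ (gT i) := by
    intro i j; rw [← map_mul, ← map_mul, gT_comm]
  obtain ⟨ω, hω, v0, hv0, e0⟩ := exists_eig (hcube 0) (by
    intro h
    exact gT_ne_one (hfaithful (h.trans (map_one ρ).symm)))
  refine ⟨ω, hω, ?_⟩
  obtain ⟨v1, hv1, ⟨k1, e1⟩, c1⟩ := eig_split hω _ (hcube 1) v0 hv0
  obtain ⟨v2, hv2, ⟨k2, e2⟩, c2⟩ := eig_split hω _ (hcube 2) v1 hv1
  obtain ⟨v3, hv3, ⟨k3, e3⟩, c3⟩ := eig_split hω _ (hcube 3) v2 hv2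
  have f0 : ρ (gT 0) v3 = ω • v3 :=
    c3 _ (hcomm _ _) _ (c2 _ (hcomm _ _) _ (c1 _ (hcomm _ _) _ e0))
  have f1 := c3 _ (hcomm _ _) _ (c2 _ (hcomm _ _) _ e1)
  have f2 := c3 _ (hcomm _ _) _ e2
  have h3 : ω ^ 3 = 1 := by linear_combination (ω - 1) * hω
  have hsum : 1 + k1 + k2 + k3 = 0 := by
    have hp : ρ (gT 0 * gT 1 * gT 2 * gT 3) v3 = v3 := by rw [gT_prod, map_one]; rfl
    simp only [map_mul, Module.End.mul_apply, e3, map_smul, f2, f1, f0, smul_smul] at hp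
    have hp2 : (ω ^ k3.val * (ω ^ k2.val * (ω ^ k1.val * ω)) - 1) • v3 = 0 := by
      rw [sub_smul, hp, one_smul, sub_self]
    have hp3 := sub_eq_zero.1 ((smul_eq_zero.1 hp2).resolve_right hv3)
    apply om_inj hω
    rw [ZMod.val_zero, pow_zero, ← hp3]
    have hh : ∀ k : ZMod 3, ∀ n : ℕ, (n : ZMod 3) = k → ω ^ k.val = ω ^ n := by
      intro k n hn
      rw [← hn, ZMod.val_natCast]
      conv_rhs => rw [← Nat.div_add_mod n 3, pow_add, pow_mul, h3, one_pow, one_mul]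
    rw [hh _ (1 + k1.val + k2.val + k3.val) (by push_cast; simp)]
    ring
  have W0 : Wt ρ ω ![1, k1, k2, k3] := by
    refine ⟨v3, hv3, fun i => ?_⟩
    fin_cases i
    · simpa [ZMod.val_one] using f0
    · exact f1
    · exact f2
    · exact e3
  have P0 : ∀ {a b c d}, Wt ρ ω ![a, b, c, d] → Wt ρ ω ![b, a, c, d] := by
    intro a b c d h
    have := wt_perm ρ ![1, 0, 2, 3] (gP 0) (by
      intro i; fin_cases i
      exacts [gP_zero.2.1, gP_zero.1, gP_zero.2.2.1, gP_zero.2.2.2]) h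
    convert this using 1
    ext i : 1; fin_cases i <;> rfl
  have P1 : ∀ {a b c d}, Wt ρ ω ![a, b, c, d] → Wt ρ ω ![a, d, b, c] := by
    intro a b c d h
    have := wt_perm ρ ![0, 3, 1, 2] (gP 1) (by
      intro i; fin_cases i
      exacts [gP_one.1, gP_one.2.2.2, gP_one.2.1, gP_one.2.2.1]) h
    convert this using 1
    ext i : 1; fin_cases i <;> rfl
  have A : Wt ρ ω ![1, 2, 0, 0] → False := by
    intro h
    refine five_wt ρ hdim hω ![![1, 2, 0, 0], ![1, 0, 2, 0], ![1, 0, 0, 2], ![2, 1, 0, 0], ![2, 0, 1, 0]]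
      (by decide +kernel) ?_
    intro j
    fin_cases j
    exacts [h, P1 h, P1 (P1 h), P0 h, P1 (P0 h)]
  have B : Wt ρ ω ![1, 1, 2, 2] → False := by
    intro h
    refine five_wt ρ hdim hω ![![1, 1, 2, 2], ![1, 2, 1, 2], ![1, 2, 2, 1], ![2, 1, 1, 2], ![2, 2, 1, 1]]
      (by decide +kernel) ?_
    intro j
    fin_cases j
    exacts [h, P1 h, P1 (P1 h), P0 (P1 h), P1 (P0 (P1 h))]
  have C : Wt ρ ω ![1, 1, 1, 0] := by
    have key : ∀ k1 k2 k3 : ZMod 3, 1 + k1 + k2 + k3 = 0 →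
      (![1, k1, k2, k3] = ![1, 1, 1, 0] ∨ ![1, k3, k1, k2] = ![1, 1, 1, 0] ∨ ![1, k2, k3, k1] = ![1, 1, 1, 0]) ∨
      (![1, k1, k2, k3] = ![1, 2, 0, 0] ∨ ![1, k3, k1, k2] = ![1, 2, 0, 0] ∨ ![1, k2, k3, k1] = ![1, 2, 0, 0]) ∨
      (![1, k1, k2, k3] = ![1, 1, 2, 2] ∨ ![1, k3, k1, k2] = ![1, 1, 2, 2] ∨ ![1, k2, k3, k1] = ![1, 1, 2, 2]) := by
      decide +kernel
    rcases key k1 k2 k3 hsum with (h | h | h) | (h | h | h) | (h | h | h)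
    · exact h ▸ W0
    · exact h ▸ P1 W0
    · exact h ▸ P1 (P1 W0)
    · exact (A (h ▸ W0)).elim
    · exact (A (h ▸ P1 W0)).elim
    · exact (A (h ▸ P1 (P1 W0))).elim
    · exact (B (h ▸ W0)).elim
    · exact (B (h ▸ P1 W0)).elim
    · exact (B (h ▸ P1 (P1 W0))).elim
  have D : ∀ j : Fin 4, Wt ρ ω (fun i => if i = j then 0 else 1) := by
    have D' : ∀ j : Fin 4, Wt ρ ω (![![0, 1, 1, 1], ![1, 0, 1, 1], ![1, 1, 0, 1], ![1, 1, 1, 0]] j) := by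
      intro j
      fin_cases j
      exacts [P0 (P1 C), P1 C, P1 (P1 C), C]
    intro j
    convert D' j using 1
    revert j; decide
  choose b hb hb2 using D
  refine ⟨b, wt_indep ρ b (fun j i => if i = j then 1 else ω) ?_ hb ?_, ?_⟩
  · intro j j' h
    have h1 := congrFun h j
    by_contra hne
    simp only [if_true, if_neg hne] at h1
    rw [← h1] at hω; norm_num at hω
  all_goals
    intro i j
    rw [hb2]
    by_cases h : i = j
    · simp [h]
    · simp [h, ZMod.val_one]

end Weights

/-! ### Part 3: the reflections in normal form -/

section Refl

variable {V : Type} [AddCommGroup V] [Module ℂ V]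

def IsCRefl (ω : ℂ) (R : Module.End ℂ V) (a : V) (f : Module.Dual ℂ V) : Prop :=
  f a = 1 ∧ ∀ v, R v = ω • v + ((1 - ω) * f v) • a

theorem refl_comm {ω : ℂ} (hω : ω ^ 2 + ω + 1 = 0) {R T : Module.End ℂ V} {a b : V}
    {f g : Module.Dual ℂ V} (hR : IsCRefl ω R a f) (hT : IsCRefl ω T b g) (hc : R * T = T * R)
    (hne : R ≠ T) : f b = 0 ∧ g a = 0 := by
  obtain ⟨fa, hR⟩ := hR
  obtain ⟨gb, hT⟩ := hT
  have hδ : (1 - ω) ≠ 0 := by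
    intro h
    have : ω = 1 := by linear_combination -h
    rw [this] at hω; norm_num at hω
  have hb : b ≠ 0 := by rintro rfl; simp at gb
  have key : ∀ v, (f b * g v) • a = (g a * f v) • b := by
    intro v
    have h1 : R (T v) = T (R v) := congrArg (fun h => h v) hc
    rw [hR (T v), hT (R v), hT v, hR v] at h1
    simp only [map_add, map_smul, smul_eq_mul] at h1
    have h2 : ((1 - ω) * (1 - ω)) • ((f b * g v) • a - (g a * f v) • b) = 0 := by
      linear_combination (norm := module) h1
    rw [smul_eq_zero] at h2
    exact sub_eq_zero.1 (h2.resolve_left (mul_ne_zero hδ hδ))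
  have hfb : f b = 0 := by
    by_contra hfb
    have h1 : a = g a • b := by
      have h := key b
      rw [gb, mul_one, mul_comm, ← smul_smul] at h
      exact smul_right_injective V hfb h
    have h2 : g a * f b = 1 := by
      have := congrArg f h1
      rw [fa, map_smul, smul_eq_mul] at this
      exact this.symm
    apply hne
    ext v
    rw [hR, hT]
    have h3 := key v
    rw [h1, smul_smul] at h3
    simp only [map_smul, gb, smul_eq_mul, mul_one] at h3
    have h4 := smul_left_injective ℂ hb h3
    have h5 : g v = g a * f v := by linear_combination h4 - g v * h2
    rw [h1, h5]
    simp only [map_smul, gb, smul_eq_mul, mul_one, smul_smul]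
    congr 2
    ring
  refine ⟨hfb, ?_⟩
  have h := key a
  rw [hfb, fa, zero_mul, zero_smul, mul_one] at h
  exact (smul_eq_zero.1 h.symm).resolve_right hb

theorem refl_braid {ω : ℂ} (hω : ω ^ 2 + ω + 1 = 0) {R T : Module.End ℂ V} {a b : V}
    {f g : Module.Dual ℂ V} (hR : IsCRefl ω R a f) (hT : IsCRefl ω T b g)
    (hc : R * T * R = T * R * T) (hne : R ≠ T) : g a * f b = 1 / 3 := by
  obtain ⟨fa, hR⟩ := hR
  obtain ⟨gb, hT⟩ := hT
  have hδ : (1 - ω) ≠ 0 := by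
    intro h
    have : ω = 1 := by linear_combination -h
    rw [this] at hω; norm_num at hω
  have hk : ω ^ 2 + ω * (1 - ω) + (1 - ω) ^ 2 * (g a * f b) = 0 := by
    by_contra hk
    apply hne
    ext v
    have h1 : R (T (R v)) = T (R (T v)) := congrArg (fun h => h v) hc
    have h2 : ((1 - ω) * (ω ^ 2 + ω * (1 - ω) + (1 - ω) ^ 2 * (g a * f b))) • (f v • a - g v • b) = 0 := by
      simp only [hR, hT, map_add, map_smul, smul_eq_mul, fa, gb, mul_one] at h1
      linear_combination (norm := module) h1
    rw [smul_eq_zero] at h2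
    have h3 := sub_eq_zero.1 (h2.resolve_left (mul_ne_zero hδ hk))
    rw [hR, hT, ← smul_smul, ← smul_smul, h3]
  have hd2 : (1 - ω) ^ 2 = -3 * ω := by linear_combination hω
  rw [hd2] at hk
  have hω0 : ω ≠ 0 := by rintro rfl; norm_num at hω
  have : ω * (1 - 3 * (g a * f b)) = 0 := by linear_combination hk
  have := (mul_eq_zero.1 this).resolve_left hω0
  linear_combination -this / 3

/-- signs -/
def sg : Fin 4 → Fin 4 → ℂ :=
  ![![0, 1, -1, 1], ![1, 0, -1, -1], ![1, -1, 0, 1], ![1, 1, 1, 0]]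

theorem exists_normal_form (ρ : Representation ℂ Sp4F3 V) [FiniteDimensional ℂ V]
    (hfaithful : Function.Injective ρ) (hdim : Module.finrank ℂ V = 4) :
    ∃ ω : ℂ, ω ^ 2 + ω + 1 = 0 ∧ ∃ c : Module.Basis (Fin 4) ℂ V,
      (∀ i j, ρ (gT i) (c j) = (if i = j then 1 else ω) • c j) ∧
      ∀ i k, ρ (gR i) (c k) = ω • c k + ((1 - ω) / 3 * sg i k) • ∑ l, sg i l • c l := by
  obtain ⟨ω, hω, b0, hb0, hT0⟩ := exists_wt_basis ρ hfaithful hdim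
  refine ⟨ω, hω, ?_⟩
  let b : Module.Basis (Fin 4) ℂ V := basisOfLinearIndependentOfCardEqFinrank hb0 (by simp [hdim])
  have hbb : ∀ i, b i = b0 i := fun i => by simp [b]
  have hT : ∀ i, IsCRefl ω (ρ (gT i)) (b i) (b.coord i) := by
    intro i
    refine ⟨by simp, ?_⟩
    have : ρ (gT i) = ω • LinearMap.id + (1 - ω) • (LinearMap.toSpanSingleton ℂ V (b i) ∘ₗ b.coord i) := by
      apply b.ext
      intro j
      rw [hbb, hT0]
      simp only [LinearMap.add_apply, LinearMap.smul_apply, LinearMap.id_apply, LinearMap.comp_apply,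
        LinearMap.toSpanSingleton_apply, ← hbb, Module.Basis.coord_apply, Module.Basis.repr_self]
      by_cases h : i = j
      · subst h; simp
      · rw [Finsupp.single_eq_of_ne h]; simp [h]
    intro v
    rw [this]
    simp only [LinearMap.add_apply, LinearMap.smul_apply, LinearMap.id_apply, LinearMap.comp_apply,
        LinearMap.toSpanSingleton_apply, smul_smul]
  have hR : ∀ i, ∃ a f, IsCRefl ω (ρ (gR i)) a f := by
    intro i
    obtain ⟨j, hj⟩ : ∃ j, i ≠ j := ⟨i + 1, by revert i; decide⟩
    set q := gT j * gR i with hq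
    have h1 : q * gT j = gR i * q := by
      rw [hq, ← gRT_braid i j hj, mul_assoc]
    have h2 : gR i = q * gT j * q⁻¹ := by rw [h1, mul_inv_cancel_right]
    have hqq : ∀ v, ρ q (ρ q⁻¹ v) = v := fun v => by
      rw [← Module.End.mul_apply, ← map_mul, mul_inv_cancel, map_one]; rfl
    have hqq' : ∀ v, ρ q⁻¹ (ρ q v) = v := fun v => by
      rw [← Module.End.mul_apply, ← map_mul, inv_mul_cancel, map_one]; rfl
    refine ⟨ρ q (b j), b.coord j ∘ₗ ρ q⁻¹, ?_, fun v => ?_⟩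
    · rw [LinearMap.comp_apply, hqq']; exact (hT j).1
    · rw [h2, map_mul, map_mul, Module.End.mul_apply, Module.End.mul_apply, (hT j).2, map_add, map_smul,
        map_smul, hqq]
      rfl
  choose a f hR using hR
  have hne : ∀ i j, ρ (gR i) ≠ ρ (gT j) := fun i j h => gR_ne_gT i j (hfaithful h)
  have hRR : ∀ i j, i ≠ j → f i (a j) = 0 := by
    intro i j hij
    refine (refl_comm hω (hR i) (hR j) ?_ ?_).1
    · change ρ (gR i) * ρ (gR j) = ρ (gR j) * ρ (gR i)
      rw [← map_mul, ← map_mul, gR_comm]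
    · intro h
      have : gR i = gR j := hfaithful h
      have h2 : ∀ i j, i ≠ j → gR i ≠ gR j := by
        simp only [ne_eq, Subtype.ext_iff]; decide +kernel
      exact h2 i j hij this
  have hcom : ∀ i, f i (b i) = 0 ∧ b.coord i (a i) = 0 := by
    intro i
    refine refl_comm hω (hR i) (hT i) ?_ (hne i i)
    change ρ (gR i) * ρ (gT i) = ρ (gT i) * ρ (gR i)
    rw [← map_mul, ← map_mul, gRT_comm]
  have hbr : ∀ i j, i ≠ j → b.coord j (a i) * f i (b j) = 1 / 3 := by
    intro i j hij
    refine refl_braid hω (hR i) (hT j) ?_ (hne i j)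
    change ρ (gR i) * ρ (gT j) * ρ (gR i) = ρ (gT j) * ρ (gR i) * ρ (gT j)
    rw [← map_mul, ← map_mul, ← map_mul, ← map_mul, gRT_braid i j hij]
  -- coordinates
  set α : Fin 4 → Fin 4 → ℂ := fun i k => b.coord k (a i) with hα
  have ha : ∀ i, a i = ∑ k, α i k • b k := fun i => (b.sum_repr (a i)).symm
  have hα0 : ∀ i, α i i = 0 := fun i => (hcom i).2
  have hαne : ∀ i k, i ≠ k → α i k ≠ 0 := by
    intro i k h h0
    have := hbr i k h
    change α i k * _ = _ at this
    rw [h0] at this; norm_num at this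
  have hβ : ∀ i k, i ≠ k → f i (b k) = 1 / (3 * α i k) := by
    intro i k h
    have h1 := hbr i k h
    change α i k * _ = _ at h1
    have := hαne i k h
    field_simp
    linear_combination 3 * h1
  have horth : ∀ i j, i ≠ j → ∑ k, α j k * f i (b k) = 0 := by
    intro i j h
    have := hRR i j h
    rw [ha j, map_sum] at this
    simpa using this
  -- scaling
  obtain ⟨s, t, hs, ht⟩ : ∃ s t : Fin 4 → ℂ, (∀ k, s k ≠ 0) ∧ ∀ i k, α i k = t i * sg i k * s k := by
    have n01 := hαne 0 1 (by decide)
    have n02 := hαne 0 2 (by decide)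
    have n03 := hαne 0 3 (by decide)
    have n30 := hαne 3 0 (by decide)
    have n31 := hαne 3 1 (by decide)
    have n32 := hαne 3 2 (by decide)
    have o30 := horth 3 0 (by decide)
    have o31 := horth 3 1 (by decide)
    have o32 := horth 3 2 (by decide)
    have o01 := horth 0 1 (by decide)
    have o02 := horth 0 2 (by decide)
    have c0 := fun i => (hcom i).1
    simp only [Fin.sum_univ_four, hα0, zero_mul, zero_add, add_zero, c0, mul_zero] at o30 o31 o32 o01 o02
    rw [hβ 3 1 (by decide), hβ 3 2 (by decide)] at o30
    rw [hβ 3 0 (by decide), hβ 3 2 (by decide)] at o31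
    rw [hβ 3 0 (by decide), hβ 3 1 (by decide)] at o32
    rw [hβ 0 2 (by decide), hβ 0 3 (by decide)] at o01
    rw [hβ 0 1 (by decide), hβ 0 3 (by decide)] at o02
    field_simp at o30 o31 o32 o01 o02
    have z0 := hα0 0
    have z1 := hα0 1
    have z2 := hα0 2
    have z3 := hα0 3
    generalize α = A at *
    refine ⟨![A 3 0, A 3 1, A 3 2, A 0 3 * A 3 1 / A 0 1],
      ![A 0 1 / A 3 1, A 1 0 / A 3 0, A 2 0 / A 3 0, 1], ?_, ?_⟩
    · intro k
      fin_cases k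
      · exact n30
      · exact n31
      · exact n32
      · exact div_ne_zero (mul_ne_zero n03 n31) n01
    · have e02 : A 0 2 = - (A 0 1 / A 3 1) * A 3 2 := by
        field_simp; linear_combination o30
      have e12 : A 1 2 = - (A 1 0 / A 3 0) * A 3 2 := by
        field_simp; linear_combination o31
      have e21 : A 2 1 = - (A 2 0 / A 3 0) * A 3 1 := by
        field_simp; linear_combination o32
      have e13 : A 1 3 = - (A 1 0 / A 3 0) * (A 0 3 * A 3 1 / A 0 1) := by
        have : A 1 3 * A 0 2 = - (A 1 2 * A 0 3) := by linear_combination o01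
        rw [e02, e12] at this
        field_simp at this ⊢
        linear_combination -this
      have e23 : A 2 3 = (A 2 0 / A 3 0) * (A 0 3 * A 3 1 / A 0 1) := by
        have : A 2 3 * A 0 1 = - (A 2 1 * A 0 3) := by linear_combination o02
        rw [e21] at this
        field_simp at this ⊢
        linear_combination this
      intro i k
      fin_cases i <;> fin_cases k <;> simp [sg, z0, z1, z2, z3, e02, e12, e21, e13, e23] <;> field_simp
  let c := b.unitsSMul (fun k => Units.mk0 (s k) (hs k))
  have hc : ∀ k, c k = s k • b k := fun k => by simp [c, Module.Basis.unitsSMul_apply, Units.smul_def]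
  refine ⟨c, fun i j => ?_, fun i k => ?_⟩
  · rw [hc, map_smul, hbb, hT0, smul_comm]
  · rw [hc, (hR i).2, map_smul, smul_smul, smul_eq_mul]
    congr 1
    by_cases hik : i = k
    · subst hik
      have : sg i i = 0 := by fin_cases i <;> simp [sg]
      rw [(hcom i).1, this]; simp
    · have h1 : sg i k * sg i k = 1 := by
        fin_cases i <;> fin_cases k <;> simp [sg] at hik ⊢
      have hti := hαne i k hik
      rw [ht] at hti
      have hti0 : t i ≠ 0 := by intro h; rw [h] at hti; simp at hti
      have hsk := hs k
      have hsg : sg i k ≠ 0 := by intro h; rw [h] at hti; simp at hti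
      rw [ha, hβ i k hik, Finset.smul_sum, Finset.smul_sum]
      refine Finset.sum_congr rfl fun l _ => ?_
      rw [hc, smul_smul, smul_smul, smul_smul, ht i k, ht i l]
      congr 1
      field_simp
      linear_combination (-(1 - ω) * sg i l * s l) * h1

end Refl

/-! ### Part 4: frames and weight projections -/

section Frames

variable {V : Type} [AddCommGroup V] [Module ℂ V]

abbrev FF (V : Type) [AddCommGroup V] [Module ℂ V] : Type := Module.Dual ℂ V → ℂ

noncomputable def symAlg (ρ : Representation ℂ Sp4F3 V) (g : Sp4F3) : FF V →ₐ[ℂ] FF V where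
  toFun := symAct ρ g
  map_one' := rfl
  map_mul' _ _ := rfl
  map_zero' := rfl
  map_add' _ _ := rfl
  commutes' _ := rfl

def Pres (ρ : Representation ℂ Sp4F3 V) (L : FF V → FF V) : Prop :=
  ∀ W, IsSubrep ρ W → ∀ f ∈ W, L f ∈ W

def mn (x y z w : FF V) (a b c d : ℕ) : FF V := x ^ a * y ^ b * z ^ c * w ^ d

structure IsFrame (ρ : Representation ℂ Sp4F3 V) (ω : ℂ) (x y z w : FF V) : Prop where
  tx : ∃ T : FF V →ₐ[ℂ] FF V, Pres ρ T ∧ T x = x ∧ T y = ω • y ∧ T z = ω • z ∧ T w = ω • w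
  ty : ∃ T : FF V →ₐ[ℂ] FF V, Pres ρ T ∧ T x = ω • x ∧ T y = y ∧ T z = ω • z ∧ T w = ω • w
  tz : ∃ T : FF V →ₐ[ℂ] FF V, Pres ρ T ∧ T x = ω • x ∧ T y = ω • y ∧ T z = z ∧ T w = ω • w
  tw : ∃ T : FF V →ₐ[ℂ] FF V, Pres ρ T ∧ T x = ω • x ∧ T y = ω • y ∧ T z = ω • z ∧ T w = w
  r : ∃ R : FF V →ₐ[ℂ] FF V, Pres ρ R ∧ R x = ω • x + ((1 - ω) / 3) • (x + y + z) ∧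
    R y = ω • y + ((1 - ω) / 3) • (x + y + z) ∧ R z = ω • z + ((1 - ω) / 3) • (x + y + z) ∧
    R w = ω • w

theorem IsFrame.swap {ρ : Representation ℂ Sp4F3 V} {ω : ℂ} {x y z w : FF V}
    (h : IsFrame ρ ω x y z w) : IsFrame ρ ω y x z w := by
  obtain ⟨⟨T1, a1, b1, c1, d1, e1⟩, ⟨T2, a2, b2, c2, d2, e2⟩, ⟨T3, a3, b3, c3, d3, e3⟩,
    ⟨T4, a4, b4, c4, d4, e4⟩, ⟨R, a, b, c, d, e⟩⟩ := h
  refine ⟨⟨T2, a2, c2, b2, d2, e2⟩, ⟨T1, a1, c1, b1, d1, e1⟩, ⟨T3, a3, c3, b3, d3, e3⟩,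
    ⟨T4, a4, c4, b4, d4, e4⟩, ⟨R, a, ?_, ?_, ?_, e⟩⟩
  · rw [c, add_comm x y]
  · rw [b, add_comm x y]
  · rw [d, add_comm x y]

theorem IsFrame.rot {ρ : Representation ℂ Sp4F3 V} {ω : ℂ} {x y z w : FF V}
    (h : IsFrame ρ ω x y z w) : IsFrame ρ ω y z x w := by
  obtain ⟨⟨T1, a1, b1, c1, d1, e1⟩, ⟨T2, a2, b2, c2, d2, e2⟩, ⟨T3, a3, b3, c3, d3, e3⟩,
    ⟨T4, a4, b4, c4, d4, e4⟩, ⟨R, a, b, c, d, e⟩⟩ := h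
  have hh : y + z + x = x + y + z := by ring
  refine ⟨⟨T2, a2, c2, d2, b2, e2⟩, ⟨T3, a3, c3, d3, b3, e3⟩, ⟨T1, a1, c1, d1, b1, e1⟩,
    ⟨T4, a4, c4, d4, b4, e4⟩, ⟨R, a, ?_, ?_, ?_, e⟩⟩
  · rw [c, hh]
  · rw [d, hh]
  · rw [b, hh]

theorem pr_exists {ρ : Representation ℂ Sp4F3 V} {ω : ℂ} (hω : ω ^ 2 + ω + 1 = 0)
    (T : FF V →ₐ[ℂ] FF V) (hT : Pres ρ T) (k : ℕ) (hk : k < 3) :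
    ∃ π : FF V →ₗ[ℂ] FF V, Pres ρ π ∧
      ∀ f n, n ≤ 5 → T f = ω ^ (5 - n) • f → π f = if n % 3 = k then f else 0 := by
  have h3 : ω ^ 3 = 1 := by linear_combination (ω - 1) * hω
  have hj : ∀ j, 1 + ω ^ j + ω ^ (2 * j) = if j % 3 = 0 then (3 : ℂ) else 0 := by
    intro j
    have h1 : ω ^ j = ω ^ (j % 3) := by
      conv_lhs => rw [← Nat.div_add_mod j 3, pow_add, pow_mul, h3, one_pow, one_mul]
    rw [mul_comm 2 j, pow_mul, h1]
    have : j % 3 < 3 := Nat.mod_lt _ (by norm_num)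
    generalize j % 3 = r at *
    interval_cases r
    · norm_num
    · simp; linear_combination hω
    · simp; linear_combination (ω ^ 2 - ω + 1) * hω
  refine ⟨(1 / 3 : ℂ) • (LinearMap.id + ω ^ (k + 1) • T.toLinearMap +
    ω ^ (2 * (k + 1)) • (T.toLinearMap ∘ₗ T.toLinearMap)), ?_, ?_⟩
  · intro W hW f hf
    have h1 := hT W hW f hf
    have h2 := hT W hW _ h1
    exact W.smul_mem _ (W.add_mem (W.add_mem hf (W.smul_mem _ h1)) (W.smul_mem _ h2))
  · intro f n hn hf
    have h1 := hj (5 - n + (k + 1))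
    have h2 : (5 - n + (k + 1)) % 3 = 0 ↔ n % 3 = k := by omega
    simp only [h2] at h1
    simp only [LinearMap.smul_apply, LinearMap.add_apply, LinearMap.id_apply, LinearMap.comp_apply,
      AlgHom.toLinearMap_apply, hf, map_smul, smul_smul]
    have : (1 / 3 : ℂ) • (f + (ω ^ (k + 1) * ω ^ (5 - n)) • f +
        (ω ^ (2 * (k + 1)) * (ω ^ (5 - n) * ω ^ (5 - n))) • f) =
        ((1 / 3 : ℂ) * (1 + ω ^ (5 - n + (k + 1)) + ω ^ (2 * (5 - n + (k + 1))))) • f := by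
      funext φ
      simp only [Pi.smul_apply, Pi.add_apply, smul_eq_mul]
      ring
    rw [this, h1]
    split_ifs <;> simp

theorem IsFrame.wt {ρ : Representation ℂ Sp4F3 V} {ω : ℂ} (hω : ω ^ 2 + ω + 1 = 0) {x y z w : FF V}
    (h : IsFrame ρ ω x y z w) (p q r s : ℕ) (hp : p < 3) (hq : q < 3) (hr : r < 3) (hs : s < 3) :
    ∃ π : FF V →ₗ[ℂ] FF V, Pres ρ π ∧ ∀ a b c d, a + b + c + d = 5 →
      π (mn x y z w a b c d) =
        if a % 3 = p ∧ b % 3 = q ∧ c % 3 = r ∧ d % 3 = s then mn x y z w a b c d else 0 := by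
  obtain ⟨⟨T1, a1, b1, c1, d1, e1⟩, ⟨T2, a2, b2, c2, d2, e2⟩, ⟨T3, a3, b3, c3, d3, e3⟩,
    ⟨T4, a4, b4, c4, d4, e4⟩, -⟩ := h
  obtain ⟨π1, g1, f1⟩ := pr_exists hω T1 a1 p hp
  obtain ⟨π2, g2, f2⟩ := pr_exists hω T2 a2 q hq
  obtain ⟨π3, g3, f3⟩ := pr_exists hω T3 a3 r hr
  obtain ⟨π4, g4, f4⟩ := pr_exists hω T4 a4 s hs
  refine ⟨π1 ∘ₗ π2 ∘ₗ π3 ∘ₗ π4, fun W hW f hf => g1 W hW _ (g2 W hW _ (g3 W hW _ (g4 W hW _ hf))), ?_⟩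
  intro a b c d hs
  have k1 := f1 (mn x y z w a b c d) a (by omega) (by
    rw [show 5 - a = b + c + d by omega]
    simp only [mn, map_mul, map_pow, b1, c1, d1, e1, smul_pow, mul_smul_comm, smul_mul_assoc, smul_smul, pow_add]
    congr 1; ring)
  have k2 := f2 (mn x y z w a b c d) b (by omega) (by
    rw [show 5 - b = a + c + d by omega]
    simp only [mn, map_mul, map_pow, b2, c2, d2, e2, smul_pow, mul_smul_comm, smul_mul_assoc, smul_smul, pow_add]
    congr 1; ring)
  have k3 := f3 (mn x y z w a b c d) c (by omega) (by
    rw [show 5 - c = a + b + d by omega]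
    simp only [mn, map_mul, map_pow, b3, c3, d3, e3, smul_pow, mul_smul_comm, smul_mul_assoc, smul_smul, pow_add]
    congr 1; ring)
  have k4 := f4 (mn x y z w a b c d) d (by omega) (by
    rw [show 5 - d = a + b + c by omega]
    simp only [mn, map_mul, map_pow, b4, c4, d4, e4, smul_pow, mul_smul_comm, smul_mul_assoc, smul_smul, pow_add]
    congr 1; ring)
  simp only [LinearMap.comp_apply, k4]
  by_cases h4 : d % 3 = s
  · by_cases h3 : c % 3 = r
    · by_cases h2 : b % 3 = q
      · simp [k1, k2, k3, h2, h3, h4]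
      · simp [k2, k3, h2, h3, h4]
    · simp [k3, h3, h4]
  · simp [h4]

theorem exp221 {ω : ℂ} (hω : ω ^ 2 + ω + 1 = 0) (x y z : ℂ) :
    (ω * x + (1 - ω) / 3 * (x + y + z)) ^ 2 * (ω * y + (1 - ω) / 3 * (x + y + z)) ^ 2 * (ω * z + (1 - ω) / 3 * (x + y + z)) ^ 1 =
      ((1 + 2 * ω) / 27) * (x ^ 5 * y ^ 0 * z ^ 0) + ((-1 + -2 * ω) / 27) * (x ^ 4 * y ^ 1 * z ^ 0) +
      ((2 + 1 * ω) / 27) * (x ^ 4 * y ^ 0 * z ^ 1) + ((1 + 2 * ω) / 27) * (x ^ 3 * y ^ 2 * z ^ 0) +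
      ((8 + 4 * ω) / 27) * (x ^ 3 * y ^ 1 * z ^ 1) + ((1 + -1 * ω) / 27) * (x ^ 3 * y ^ 0 * z ^ 2) +
      ((1 + 2 * ω) / 27) * (x ^ 2 * y ^ 3 * z ^ 0) + ((-6 + -3 * ω) / 27) * (x ^ 2 * y ^ 2 * z ^ 1) +
      ((3 + -3 * ω) / 27) * (x ^ 2 * y ^ 1 * z ^ 2) + ((1 + 2 * ω) / 27) * (x ^ 2 * y ^ 0 * z ^ 3) +
      ((-1 + -2 * ω) / 27) * (x ^ 1 * y ^ 4 * z ^ 0) + ((8 + 4 * ω) / 27) * (x ^ 1 * y ^ 3 * z ^ 1) +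
      ((3 + -3 * ω) / 27) * (x ^ 1 * y ^ 2 * z ^ 2) + ((-4 + -8 * ω) / 27) * (x ^ 1 * y ^ 1 * z ^ 3) +
      ((2 + 1 * ω) / 27) * (x ^ 1 * y ^ 0 * z ^ 4) + ((1 + 2 * ω) / 27) * (x ^ 0 * y ^ 5 * z ^ 0) +
      ((2 + 1 * ω) / 27) * (x ^ 0 * y ^ 4 * z ^ 1) + ((1 + -1 * ω) / 27) * (x ^ 0 * y ^ 3 * z ^ 2) +
      ((1 + 2 * ω) / 27) * (x ^ 0 * y ^ 2 * z ^ 3) + ((2 + 1 * ω) / 27) * (x ^ 0 * y ^ 1 * z ^ 4) +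
      ((1 + -1 * ω) / 27) * (x ^ 0 * y ^ 0 * z ^ 5) := by
  linear_combination (((-8/243)*ω^0+(-1/27)*ω^1+(4/81)*ω^2+(-4/243)*ω^3)*(x^5*y^0*z^0) + ((14/243)*ω^0+(1/27)*ω^1+(-10/81)*ω^2+(16/243)*ω^3)*(x^4*y^1*z^0) +
    ((-13/243)*ω^0+(2/81)*ω^1+(-2/81)*ω^2+(4/243)*ω^3)*(x^4*y^0*z^1) + ((1/243)*ω^0+(-1/27)*ω^1+(4/81)*ω^2+(-13/243)*ω^3)*(x^3*y^2*z^0) +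
    ((-52/243)*ω^0+(8/81)*ω^1+(10/81)*ω^2+(-38/243)*ω^3)*(x^3*y^1*z^1) + ((1/243)*ω^0+(2/81)*ω^1+(-2/27)*ω^2+(11/243)*ω^3)*(x^3*y^0*z^2) +
    ((1/243)*ω^0+(-1/27)*ω^1+(4/81)*ω^2+(-13/243)*ω^3)*(x^2*y^3*z^0) + ((28/81)*ω^0+(-5/27)*ω^1+(-1/27)*ω^2+(26/81)*ω^3)*(x^2*y^2*z^1) +
    ((1/81)*ω^0+(2/27)*ω^1+(-7/81)*ω^3)*(x^2*y^1*z^2) + ((1/243)*ω^0+(-1/9)*ω^1+(7/81)*ω^2+(-4/243)*ω^3)*(x^2*y^0*z^3) +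
    ((14/243)*ω^0+(1/27)*ω^1+(-10/81)*ω^2+(16/243)*ω^3)*(x^1*y^4*z^0) + ((-52/243)*ω^0+(8/81)*ω^1+(10/81)*ω^2+(-38/243)*ω^3)*(x^1*y^3*z^1) +
    ((1/81)*ω^0+(2/27)*ω^1+(-7/81)*ω^3)*(x^1*y^2*z^2) + ((56/243)*ω^0+(-16/81)*ω^2+(28/243)*ω^3)*(x^1*y^1*z^3) +
    ((-13/243)*ω^0+(-1/81)*ω^1+(4/81)*ω^2+(-5/243)*ω^3)*(x^1*y^0*z^4) + ((-8/243)*ω^0+(-1/27)*ω^1+(4/81)*ω^2+(-4/243)*ω^3)*(x^0*y^5*z^0) +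
    ((-13/243)*ω^0+(2/81)*ω^1+(-2/81)*ω^2+(4/243)*ω^3)*(x^0*y^4*z^1) + ((1/243)*ω^0+(2/81)*ω^1+(-2/27)*ω^2+(11/243)*ω^3)*(x^0*y^3*z^2) +
    ((1/243)*ω^0+(-1/9)*ω^1+(7/81)*ω^2+(-4/243)*ω^3)*(x^0*y^2*z^3) + ((-13/243)*ω^0+(-1/81)*ω^1+(4/81)*ω^2+(-5/243)*ω^3)*(x^0*y^1*z^4) +
    ((-8/243)*ω^0+(5/81)*ω^1+(-1/27)*ω^2+(2/243)*ω^3)*(x^0*y^0*z^5)) * hω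

theorem IsFrame.mem221 {ρ : Representation ℂ Sp4F3 V} {ω : ℂ} (hω : ω ^ 2 + ω + 1 = 0) {x y z w : FF V}
    (h : IsFrame ρ ω x y z w) {W : Submodule ℂ (FF V)} (hW : IsSubrep ρ W)
    (hm : mn x y z w 2 2 1 0 ∈ W) :
      ((1 + 2 * ω) / 27) • mn x y z w 5 0 0 0 + ((-1 + -2 * ω) / 27) • mn x y z w 4 1 0 0 +
      ((2 + 1 * ω) / 27) • mn x y z w 4 0 1 0 + ((1 + 2 * ω) / 27) • mn x y z w 3 2 0 0 +
      ((8 + 4 * ω) / 27) • mn x y z w 3 1 1 0 + ((1 + -1 * ω) / 27) • mn x y z w 3 0 2 0 +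
      ((1 + 2 * ω) / 27) • mn x y z w 2 3 0 0 + ((-6 + -3 * ω) / 27) • mn x y z w 2 2 1 0 +
      ((3 + -3 * ω) / 27) • mn x y z w 2 1 2 0 + ((1 + 2 * ω) / 27) • mn x y z w 2 0 3 0 +
      ((-1 + -2 * ω) / 27) • mn x y z w 1 4 0 0 + ((8 + 4 * ω) / 27) • mn x y z w 1 3 1 0 +
      ((3 + -3 * ω) / 27) • mn x y z w 1 2 2 0 + ((-4 + -8 * ω) / 27) • mn x y z w 1 1 3 0 +
      ((2 + 1 * ω) / 27) • mn x y z w 1 0 4 0 + ((1 + 2 * ω) / 27) • mn x y z w 0 5 0 0 +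
      ((2 + 1 * ω) / 27) • mn x y z w 0 4 1 0 + ((1 + -1 * ω) / 27) • mn x y z w 0 3 2 0 +
      ((1 + 2 * ω) / 27) • mn x y z w 0 2 3 0 + ((2 + 1 * ω) / 27) • mn x y z w 0 1 4 0 +
      ((1 + -1 * ω) / 27) • mn x y z w 0 0 5 0 ∈ W := by
  obtain ⟨R, hR, hx, hy, hz, hw⟩ := h.r
  have h1 := W.smul_mem (ω ^ 0) (hR W hW _ hm)
  convert h1 using 1
  simp only [mn, map_mul, map_pow, hx, hy, hz, hw]
  funext φ
  have h2 := exp221 hω (x φ) (y φ) (z φ)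
  have h3 : ω ^ 3 = 1 := by linear_combination (ω - 1) * hω
  simp only [Pi.add_apply, Pi.smul_apply, Pi.mul_apply, Pi.pow_apply, smul_eq_mul]
  linear_combination -w φ ^ 0 * h2

theorem exp211 {ω : ℂ} (hω : ω ^ 2 + ω + 1 = 0) (x y z : ℂ) :
    (ω * x + (1 - ω) / 3 * (x + y + z)) ^ 2 * (ω * y + (1 - ω) / 3 * (x + y + z)) ^ 1 * (ω * z + (1 - ω) / 3 * (x + y + z)) ^ 1 =
      ((0 + 3 * ω) / 27) * (x ^ 4 * y ^ 0 * z ^ 0) + ((3 + 0 * ω) / 27) * (x ^ 3 * y ^ 1 * z ^ 0) +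
      ((3 + 0 * ω) / 27) * (x ^ 3 * y ^ 0 * z ^ 1) + ((9 + 9 * ω) / 27) * (x ^ 2 * y ^ 1 * z ^ 1) +
      ((0 + 3 * ω) / 27) * (x ^ 1 * y ^ 3 * z ^ 0) + ((0 + -9 * ω) / 27) * (x ^ 1 * y ^ 2 * z ^ 1) +
      ((0 + -9 * ω) / 27) * (x ^ 1 * y ^ 1 * z ^ 2) + ((0 + 3 * ω) / 27) * (x ^ 1 * y ^ 0 * z ^ 3) +
      ((3 + 0 * ω) / 27) * (x ^ 0 * y ^ 4 * z ^ 0) + ((3 + 0 * ω) / 27) * (x ^ 0 * y ^ 3 * z ^ 1) +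
      ((3 + 0 * ω) / 27) * (x ^ 0 * y ^ 1 * z ^ 3) + ((3 + 0 * ω) / 27) * (x ^ 0 * y ^ 0 * z ^ 4) := by
  linear_combination (((1/81)*ω^0+(-8/81)*ω^1+(4/81)*ω^2)*(x^4*y^0*z^0) + ((-5/81)*ω^0+(10/81)*ω^1+(-8/81)*ω^2)*(x^3*y^1*z^0) +
    ((-5/81)*ω^0+(10/81)*ω^1+(-8/81)*ω^2)*(x^3*y^0*z^1) + ((2/27)*ω^0+(-1/27)*ω^1+(-1/27)*ω^2)*(x^2*y^2*z^0) +
    ((-5/27)*ω^0+(-2/27)*ω^1+(10/27)*ω^2)*(x^2*y^1*z^1) + ((2/27)*ω^0+(-1/27)*ω^1+(-1/27)*ω^2)*(x^2*y^0*z^2) +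
    ((4/81)*ω^0+(-14/81)*ω^1+(7/81)*ω^2)*(x^1*y^3*z^0) + ((4/27)*ω^0+(4/27)*ω^1+(-5/27)*ω^2)*(x^1*y^2*z^1) +
    ((4/27)*ω^0+(4/27)*ω^1+(-5/27)*ω^2)*(x^1*y^1*z^2) + ((4/81)*ω^0+(-14/81)*ω^1+(7/81)*ω^2)*(x^1*y^0*z^3) +
    ((-8/81)*ω^0+(7/81)*ω^1+(-2/81)*ω^2)*(x^0*y^4*z^0) + ((-5/81)*ω^0+(1/81)*ω^1+(1/81)*ω^2)*(x^0*y^3*z^1) +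
    ((2/27)*ω^0+(-4/27)*ω^1+(2/27)*ω^2)*(x^0*y^2*z^2) + ((-5/81)*ω^0+(1/81)*ω^1+(1/81)*ω^2)*(x^0*y^1*z^3) +
    ((-8/81)*ω^0+(7/81)*ω^1+(-2/81)*ω^2)*(x^0*y^0*z^4)) * hω

theorem IsFrame.mem211 {ρ : Representation ℂ Sp4F3 V} {ω : ℂ} (hω : ω ^ 2 + ω + 1 = 0) {x y z w : FF V}
    (h : IsFrame ρ ω x y z w) {W : Submodule ℂ (FF V)} (hW : IsSubrep ρ W)
    (hm : mn x y z w 2 1 1 1 ∈ W) :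
      ((0 + 3 * ω) / 27) • mn x y z w 4 0 0 1 + ((3 + 0 * ω) / 27) • mn x y z w 3 1 0 1 +
      ((3 + 0 * ω) / 27) • mn x y z w 3 0 1 1 + ((9 + 9 * ω) / 27) • mn x y z w 2 1 1 1 +
      ((0 + 3 * ω) / 27) • mn x y z w 1 3 0 1 + ((0 + -9 * ω) / 27) • mn x y z w 1 2 1 1 +
      ((0 + -9 * ω) / 27) • mn x y z w 1 1 2 1 + ((0 + 3 * ω) / 27) • mn x y z w 1 0 3 1 +
      ((3 + 0 * ω) / 27) • mn x y z w 0 4 0 1 + ((3 + 0 * ω) / 27) • mn x y z w 0 3 1 1 +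
      ((3 + 0 * ω) / 27) • mn x y z w 0 1 3 1 + ((3 + 0 * ω) / 27) • mn x y z w 0 0 4 1 ∈ W := by
  obtain ⟨R, hR, hx, hy, hz, hw⟩ := h.r
  have h1 := W.smul_mem (ω ^ 2) (hR W hW _ hm)
  convert h1 using 1
  simp only [mn, map_mul, map_pow, hx, hy, hz, hw]
  funext φ
  have h2 := exp211 hω (x φ) (y φ) (z φ)
  have h3 : ω ^ 3 = 1 := by linear_combination (ω - 1) * hω
  simp only [Pi.add_apply, Pi.smul_apply, Pi.mul_apply, Pi.pow_apply, smul_eq_mul]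
  linear_combination -w φ ^ 1 * h2 - (w φ) * ((ω * x φ + (1 - ω) / 3 * (x φ + y φ + z φ)) ^ 2 * (ω * y φ + (1 - ω) / 3 * (x φ + y φ + z φ)) ^ 1 * (ω * z φ + (1 - ω) / 3 * (x φ + y φ + z φ)) ^ 1) * h3

theorem exp111 {ω : ℂ} (hω : ω ^ 2 + ω + 1 = 0) (x y z : ℂ) :
    (ω * x + (1 - ω) / 3 * (x + y + z)) ^ 1 * (ω * y + (1 - ω) / 3 * (x + y + z)) ^ 1 * (ω * z + (1 - ω) / 3 * (x + y + z)) ^ 1 =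
      ((6 + 3 * ω) / 27) * (x ^ 3 * y ^ 0 * z ^ 0) + ((9 + -9 * ω) / 27) * (x ^ 1 * y ^ 1 * z ^ 1) +
      ((6 + 3 * ω) / 27) * (x ^ 0 * y ^ 3 * z ^ 0) + ((6 + 3 * ω) / 27) * (x ^ 0 * y ^ 0 * z ^ 3) := by
  linear_combination (((-5/27)*ω^0+(2/27)*ω^1)*(x^3*y^0*z^0) + ((1/9)*ω^0+(-1/9)*ω^1)*(x^2*y^1*z^0) +
    ((1/9)*ω^0+(-1/9)*ω^1)*(x^2*y^0*z^1) + ((1/9)*ω^0+(-1/9)*ω^1)*(x^1*y^2*z^0) +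
    ((-1/9)*ω^0+(4/9)*ω^1)*(x^1*y^1*z^1) + ((1/9)*ω^0+(-1/9)*ω^1)*(x^1*y^0*z^2) +
    ((-5/27)*ω^0+(2/27)*ω^1)*(x^0*y^3*z^0) + ((1/9)*ω^0+(-1/9)*ω^1)*(x^0*y^2*z^1) +
    ((1/9)*ω^0+(-1/9)*ω^1)*(x^0*y^1*z^2) + ((-5/27)*ω^0+(2/27)*ω^1)*(x^0*y^0*z^3)) * hω

theorem IsFrame.mem111 {ρ : Representation ℂ Sp4F3 V} {ω : ℂ} (hω : ω ^ 2 + ω + 1 = 0) {x y z w : FF V}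
    (h : IsFrame ρ ω x y z w) {W : Submodule ℂ (FF V)} (hW : IsSubrep ρ W)
    (hm : mn x y z w 1 1 1 2 ∈ W) :
      ((6 + 3 * ω) / 27) • mn x y z w 3 0 0 2 + ((9 + -9 * ω) / 27) • mn x y z w 1 1 1 2 +
      ((6 + 3 * ω) / 27) • mn x y z w 0 3 0 2 + ((6 + 3 * ω) / 27) • mn x y z w 0 0 3 2 ∈ W := by
  obtain ⟨R, hR, hx, hy, hz, hw⟩ := h.r
  have h1 := W.smul_mem (ω ^ 4) (hR W hW _ hm)
  convert h1 using 1
  simp only [mn, map_mul, map_pow, hx, hy, hz, hw]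
  funext φ
  have h2 := exp111 hω (x φ) (y φ) (z φ)
  have h3 : ω ^ 3 = 1 := by linear_combination (ω - 1) * hω
  simp only [Pi.add_apply, Pi.smul_apply, Pi.mul_apply, Pi.pow_apply, smul_eq_mul]
  linear_combination -w φ ^ 2 * h2 - (w φ) ^ 2 * (ω ^ 3 + 1) * ((ω * x φ + (1 - ω) / 3 * (x φ + y φ + z φ)) ^ 1 * (ω * y φ + (1 - ω) / 3 * (x φ + y φ + z φ)) ^ 1 * (ω * z φ + (1 - ω) / 3 * (x φ + y φ + z φ)) ^ 1) * h3

theorem exp220 {ω : ℂ} (hω : ω ^ 2 + ω + 1 = 0) (x y z : ℂ) :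
    (ω * x + (1 - ω) / 3 * (x + y + z)) ^ 2 * (ω * y + (1 - ω) / 3 * (x + y + z)) ^ 2 * (ω * z + (1 - ω) / 3 * (x + y + z)) ^ 0 =
      ((0 + 3 * ω) / 27) * (x ^ 4 * y ^ 0 * z ^ 0) + ((0 + -6 * ω) / 27) * (x ^ 3 * y ^ 1 * z ^ 0) +
      ((6 + 6 * ω) / 27) * (x ^ 3 * y ^ 0 * z ^ 1) + ((0 + 9 * ω) / 27) * (x ^ 2 * y ^ 2 * z ^ 0) +
      ((9 + 0 * ω) / 27) * (x ^ 2 * y ^ 0 * z ^ 2) + ((0 + -6 * ω) / 27) * (x ^ 1 * y ^ 3 * z ^ 0) +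
      ((0 + -6 * ω) / 27) * (x ^ 1 * y ^ 0 * z ^ 3) + ((0 + 3 * ω) / 27) * (x ^ 0 * y ^ 4 * z ^ 0) +
      ((6 + 6 * ω) / 27) * (x ^ 0 * y ^ 3 * z ^ 1) + ((9 + 0 * ω) / 27) * (x ^ 0 * y ^ 2 * z ^ 2) +
      ((0 + -6 * ω) / 27) * (x ^ 0 * y ^ 1 * z ^ 3) + ((-3 + -3 * ω) / 27) * (x ^ 0 * y ^ 0 * z ^ 4) := by
  linear_combination (((1/81)*ω^0+(-8/81)*ω^1+(4/81)*ω^2)*(x^4*y^0*z^0) + ((4/81)*ω^0+(22/81)*ω^1+(-20/81)*ω^2)*(x^3*y^1*z^0) +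
    ((-14/81)*ω^0+(-2/81)*ω^1+(4/81)*ω^2)*(x^3*y^0*z^1) + ((2/27)*ω^0+(-7/27)*ω^1+(11/27)*ω^2)*(x^2*y^2*z^0) +
    ((4/27)*ω^0+(-2/27)*ω^1+(-2/27)*ω^2)*(x^2*y^1*z^1) + ((-7/27)*ω^0+(5/27)*ω^1+(-1/27)*ω^2)*(x^2*y^0*z^2) +
    ((4/81)*ω^0+(22/81)*ω^1+(-20/81)*ω^2)*(x^1*y^3*z^0) + ((4/27)*ω^0+(-2/27)*ω^1+(-2/27)*ω^2)*(x^1*y^2*z^1) +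
    ((4/27)*ω^0+(-8/27)*ω^1+(4/27)*ω^2)*(x^1*y^1*z^2) + ((4/81)*ω^0+(4/81)*ω^1+(-2/81)*ω^2)*(x^1*y^0*z^3) +
    ((1/81)*ω^0+(-8/81)*ω^1+(4/81)*ω^2)*(x^0*y^4*z^0) + ((-14/81)*ω^0+(-2/81)*ω^1+(4/81)*ω^2)*(x^0*y^3*z^1) +
    ((-7/27)*ω^0+(5/27)*ω^1+(-1/27)*ω^2)*(x^0*y^2*z^2) + ((4/81)*ω^0+(4/81)*ω^1+(-2/81)*ω^2)*(x^0*y^1*z^3) +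
    ((10/81)*ω^0+(-5/81)*ω^1+(1/81)*ω^2)*(x^0*y^0*z^4)) * hω

theorem IsFrame.mem220 {ρ : Representation ℂ Sp4F3 V} {ω : ℂ} (hω : ω ^ 2 + ω + 1 = 0) {x y z w : FF V}
    (h : IsFrame ρ ω x y z w) {W : Submodule ℂ (FF V)} (hW : IsSubrep ρ W)
    (hm : mn x y z w 2 2 0 1 ∈ W) :
      ((0 + 3 * ω) / 27) • mn x y z w 4 0 0 1 + ((0 + -6 * ω) / 27) • mn x y z w 3 1 0 1 +
      ((6 + 6 * ω) / 27) • mn x y z w 3 0 1 1 + ((0 + 9 * ω) / 27) • mn x y z w 2 2 0 1 +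
      ((9 + 0 * ω) / 27) • mn x y z w 2 0 2 1 + ((0 + -6 * ω) / 27) • mn x y z w 1 3 0 1 +
      ((0 + -6 * ω) / 27) • mn x y z w 1 0 3 1 + ((0 + 3 * ω) / 27) • mn x y z w 0 4 0 1 +
      ((6 + 6 * ω) / 27) • mn x y z w 0 3 1 1 + ((9 + 0 * ω) / 27) • mn x y z w 0 2 2 1 +
      ((0 + -6 * ω) / 27) • mn x y z w 0 1 3 1 + ((-3 + -3 * ω) / 27) • mn x y z w 0 0 4 1 ∈ W := by
  obtain ⟨R, hR, hx, hy, hz, hw⟩ := h.r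
  have h1 := W.smul_mem (ω ^ 2) (hR W hW _ hm)
  convert h1 using 1
  simp only [mn, map_mul, map_pow, hx, hy, hz, hw]
  funext φ
  have h2 := exp220 hω (x φ) (y φ) (z φ)
  have h3 : ω ^ 3 = 1 := by linear_combination (ω - 1) * hω
  simp only [Pi.add_apply, Pi.smul_apply, Pi.mul_apply, Pi.pow_apply, smul_eq_mul]
  linear_combination -w φ ^ 1 * h2 - (w φ) * ((ω * x φ + (1 - ω) / 3 * (x φ + y φ + z φ)) ^ 2 * (ω * y φ + (1 - ω) / 3 * (x φ + y φ + z φ)) ^ 2 * (ω * z φ + (1 - ω) / 3 * (x φ + y φ + z φ)) ^ 0) * h3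

end Frames


/-! ### Part 5: consequences in a frame -/

section KLemmas

variable {V : Type} [AddCommGroup V] [Module ℂ V]

theorem om_ne {ω : ℂ} (hω : ω ^ 2 + ω + 1 = 0) : ω ≠ 0 ∧ 1 + 2 * ω ≠ 0 ∧ 1 - ω ≠ 0 ∧ 2 + ω ≠ 0 := by
  refine ⟨?_, ?_, ?_, ?_⟩
  · rintro rfl; norm_num at hω
  · intro h
    have : (3 : ℂ) = 0 := by linear_combination 4 * hω - (2 * ω + 1) * h
    norm_num at this
  · intro h
    have : (3 : ℂ) = 0 := by linear_combination hω + (ω + 2) * h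
    norm_num at this
  · intro h
    have : (3 : ℂ) = 0 := by linear_combination hω - (ω - 1) * h
    norm_num at this

theorem mem_of_smul {W : Submodule ℂ (FF V)} {t : ℂ} (ht : t ≠ 0) {f g : FF V} (h : g ∈ W)
    (e : g = t • f) : f ∈ W := by
  rw [e] at h
  exact (W.smul_mem_iff ht).1 h

theorem IsFrame.k211 {ρ : Representation ℂ Sp4F3 V} {ω : ℂ} (hω : ω ^ 2 + ω + 1 = 0) {x y z w : FF V}
    (h : IsFrame ρ ω x y z w) {W : Submodule ℂ (FF V)} (hW : IsSubrep ρ W)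
    (hm : x ^ 2 * y * z * w ∈ W) :
    y ^ 2 * x * z * w ∈ W ∧ w * x * (x ^ 3 + y ^ 3 + z ^ 3) ∈ W := by
  obtain ⟨n0, n1, n2, n3⟩ := om_ne hω
  have hm' : mn x y z w 2 1 1 1 ∈ W := by simpa [mn] using hm
  have H := h.mem211 hω hW hm'
  constructor
  · obtain ⟨π, hπ, hv⟩ := h.wt hω 1 2 1 1 (by norm_num) (by norm_num) (by norm_num) (by norm_num)
    have := hπ W hW _ H
    simp [hv] at this
    refine mem_of_smul (t := -9 * ω / 27) (by simpa using n0) this ?_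
    funext φ; simp only [mn, Pi.add_apply, Pi.smul_apply, Pi.mul_apply, Pi.pow_apply, Pi.ofNat_apply, smul_eq_mul]; ring
  · obtain ⟨π, hπ, hv⟩ := h.wt hω 1 0 0 1 (by norm_num) (by norm_num) (by norm_num) (by norm_num)
    have := hπ W hW _ H
    simp [hv] at this
    refine mem_of_smul (t := 3 * ω / 27) (by simpa using n0) this ?_
    funext φ; simp only [mn, Pi.add_apply, Pi.smul_apply, Pi.mul_apply, Pi.pow_apply, Pi.ofNat_apply, smul_eq_mul]; ring

theorem IsFrame.k111 {ρ : Representation ℂ Sp4F3 V} {ω : ℂ} (hω : ω ^ 2 + ω + 1 = 0) {x y z w : FF V}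
    (h : IsFrame ρ ω x y z w) {W : Submodule ℂ (FF V)} (hW : IsSubrep ρ W)
    (hm : w ^ 2 * (x * y * z) ∈ W) : w ^ 2 * (x ^ 3 + y ^ 3 + z ^ 3) ∈ W := by
  obtain ⟨n0, n1, n2, n3⟩ := om_ne hω
  have hm' : mn x y z w 1 1 1 2 ∈ W := by
    convert hm using 1; simp only [mn]; ring
  have H := h.mem111 hω hW hm'
  obtain ⟨π, hπ, hv⟩ := h.wt hω 0 0 0 2 (by norm_num) (by norm_num) (by norm_num) (by norm_num)
  have := hπ W hW _ H
  simp [hv] at this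
  refine mem_of_smul (t := (2 + ω) / 9) (by simpa using n3) this ?_
  funext φ; simp only [mn, Pi.add_apply, Pi.smul_apply, Pi.mul_apply, Pi.pow_apply, Pi.ofNat_apply, smul_eq_mul]; ring

theorem IsFrame.k221 {ρ : Representation ℂ Sp4F3 V} {ω : ℂ} (hω : ω ^ 2 + ω + 1 = 0) {x y z w : FF V}
    (h : IsFrame ρ ω x y z w) {W : Submodule ℂ (FF V)} (hW : IsSubrep ρ W)
    (hm : x ^ 2 * y ^ 2 * z ∈ W) :
    y ^ 2 * z ^ 2 * x ∈ W ∧ x ^ 2 * (x ^ 3 + y ^ 3 + z ^ 3) ∈ W ∧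
      x * y * (x ^ 3 + y ^ 3 + 4 * z ^ 3) ∈ W := by
  obtain ⟨n0, n1, n2, n3⟩ := om_ne hω
  have hm' : mn x y z w 2 2 1 0 ∈ W := by simpa [mn] using hm
  have H := h.mem221 hω hW hm'
  refine ⟨?_, ?_, ?_⟩
  · obtain ⟨π, hπ, hv⟩ := h.wt hω 1 2 2 0 (by norm_num) (by norm_num) (by norm_num) (by norm_num)
    have := hπ W hW _ H
    simp [hv] at this
    refine mem_of_smul (t := (1 - ω) / 9) (by simpa using n2) this ?_
    funext φ; simp only [mn, Pi.add_apply, Pi.smul_apply, Pi.mul_apply, Pi.pow_apply, Pi.ofNat_apply, smul_eq_mul]; ring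
  · obtain ⟨π, hπ, hv⟩ := h.wt hω 2 0 0 0 (by norm_num) (by norm_num) (by norm_num) (by norm_num)
    have := hπ W hW _ H
    simp [hv] at this
    refine mem_of_smul (t := (1 + 2 * ω) / 27) (by simpa using n1) this ?_
    funext φ; simp only [mn, Pi.add_apply, Pi.smul_apply, Pi.mul_apply, Pi.pow_apply, Pi.ofNat_apply, smul_eq_mul]; ring
  · obtain ⟨π, hπ, hv⟩ := h.wt hω 1 1 0 0 (by norm_num) (by norm_num) (by norm_num) (by norm_num)
    have := hπ W hW _ H
    simp [hv] at this
    refine mem_of_smul (t := -((1 + 2 * ω) / 27)) (by simpa using n1) this ?_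
    funext φ; simp only [mn, Pi.add_apply, Pi.smul_apply, Pi.mul_apply, Pi.pow_apply, Pi.ofNat_apply, smul_eq_mul]; ring

theorem IsFrame.k220 {ρ : Representation ℂ Sp4F3 V} {ω : ℂ} (hω : ω ^ 2 + ω + 1 = 0) {x y z w : FF V}
    (h : IsFrame ρ ω x y z w) {W : Submodule ℂ (FF V)} (hW : IsSubrep ρ W)
    (hm : x ^ 2 * y ^ 2 * w ∈ W) : x ^ 2 * z ^ 2 * w ∈ W := by
  have hm' : mn x y z w 2 2 0 1 ∈ W := by simpa [mn] using hm
  have H := h.mem220 hω hW hm'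
  obtain ⟨π, hπ, hv⟩ := h.wt hω 2 0 2 1 (by norm_num) (by norm_num) (by norm_num) (by norm_num)
  have := hπ W hW _ H
  simp [hv] at this
  refine mem_of_smul (t := 1 / 3) (by norm_num) this ?_
  funext φ; simp only [mn, Pi.add_apply, Pi.smul_apply, Pi.mul_apply, Pi.pow_apply, Pi.ofNat_apply, smul_eq_mul]; ring

/-- the five vectors of a frame in the 20-dimensional piece -/
def fr1 (x y z w : FF V) : Fin 5 → FF V :=
  ![w ^ 2 * (x * y * z), w ^ 2 * (x ^ 3 + y ^ 3 + z ^ 3), w * x * (x ^ 3 + y ^ 3 + z ^ 3),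
    w * y * (x ^ 3 + y ^ 3 + z ^ 3), w * z * (x ^ 3 + y ^ 3 + z ^ 3)]

/-- the nine vectors of a frame in the 36-dimensional piece -/
def fr2 (x y z : FF V) : Fin 9 → FF V :=
  ![x ^ 2 * y ^ 2 * z, y ^ 2 * z ^ 2 * x, z ^ 2 * x ^ 2 * y,
    x ^ 2 * (x ^ 3 + y ^ 3 + z ^ 3), y ^ 2 * (x ^ 3 + y ^ 3 + z ^ 3), z ^ 2 * (x ^ 3 + y ^ 3 + z ^ 3),
    x * y * (x ^ 3 + y ^ 3 + 4 * z ^ 3), y * z * (y ^ 3 + z ^ 3 + 4 * x ^ 3),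
    z * x * (z ^ 3 + x ^ 3 + 4 * y ^ 3)]

theorem IsFrame.fr1_mem {ρ : Representation ℂ Sp4F3 V} {ω : ℂ} (hω : ω ^ 2 + ω + 1 = 0) {x y z w : FF V}
    (h : IsFrame ρ ω x y z w) {W : Submodule ℂ (FF V)} (hW : IsSubrep ρ W)
    (hm : x ^ 2 * y * z * w ∈ W) (hm' : w ^ 2 * (x * y * z) ∈ W) (i : Fin 5) : fr1 x y z w i ∈ W := by
  have a1 := h.k211 hω hW hm
  have a2 := h.swap.k211 hω hW a1.1
  have a3 : y ^ 2 * z * x * w ∈ W := by convert a1.1 using 1; ring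
  have a4 := h.rot.k211 hω hW a3
  have a5 : z ^ 2 * x * y * w ∈ W := by convert a4.1 using 1; ring
  have a6 := h.rot.rot.k211 hω hW a5
  fin_cases i
  · exact hm'
  · exact h.k111 hω hW hm'
  · exact a1.2
  · convert a2.2 using 1; simp only [fr1]; simp; ring
  · convert a6.2 using 1; simp only [fr1]; simp; ring

theorem IsFrame.fr2_mem {ρ : Representation ℂ Sp4F3 V} {ω : ℂ} (hω : ω ^ 2 + ω + 1 = 0) {x y z w : FF V}
    (h : IsFrame ρ ω x y z w) {W : Submodule ℂ (FF V)} (hW : IsSubrep ρ W)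
    (hm : x ^ 2 * y ^ 2 * z ∈ W) (i : Fin 9) : fr2 x y z i ∈ W := by
  have a1 := h.k221 hω hW hm
  have a2 := h.rot.k221 hω hW a1.1
  have a3 := h.rot.rot.k221 hω hW a2.1
  fin_cases i
  · exact hm
  · exact a1.1
  · exact a2.1
  · exact a1.2.1
  · convert a2.2.1 using 1; simp only [fr2]; simp; ring
  · convert a3.2.1 using 1; simp only [fr2]; simp; ring
  · exact a1.2.2
  · exact a2.2.2
  · exact a3.2.2

end KLemmas


/-! ### Part 6: symmetric power in coordinates, irreducibility criterion -/

section SymBasis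

variable {V : Type} [AddCommGroup V] [Module ℂ V]

noncomputable def Xc (c : Module.Basis (Fin 4) ℂ V) (i : Fin 4) : FF V := fun φ => φ (c i)

abbrev TT : Type := {m : Fin 4 → Fin 6 // ∑ i, (m i : ℕ) = 5}

noncomputable def Mo (c : Module.Basis (Fin 4) ℂ V) (m : TT) : FF V := ∏ i, Xc c i ^ (m.1 i : ℕ)

theorem card_TT : Fintype.card TT = 56 := by decide +kernel

noncomputable def Qc (c : Module.Basis (Fin 4) ℂ V) : MvPolynomial (Fin 4) ℂ →ₐ[ℂ] FF V :=
  MvPolynomial.aeval (Xc c)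

theorem Qc_apply (c : Module.Basis (Fin 4) ℂ V) (p : MvPolynomial (Fin 4) ℂ) (φ : Module.Dual ℂ V) :
    Qc c p φ = MvPolynomial.eval (fun i => φ (c i)) p := by
  have : (Pi.evalAlgHom ℂ (fun _ : Module.Dual ℂ V => ℂ) φ).comp (Qc c) =
      MvPolynomial.aeval (fun i => φ (c i)) := by
    apply MvPolynomial.algHom_ext
    intro i
    simp [Qc, Xc]
  have h := congrArg (fun f => f p) this
  simpa using h

theorem Qc_inj (c : Module.Basis (Fin 4) ℂ V) : Function.Injective (Qc c) := by
  intro p q h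
  apply MvPolynomial.funext
  intro x
  have := congrFun h (c.constr ℂ x)
  rw [Qc_apply, Qc_apply] at this
  simpa using this

noncomputable def toF (m : TT) : Fin 4 →₀ ℕ := Finsupp.equivFunOnFinite.symm (fun i => (m.1 i : ℕ))

theorem toF_inj : Function.Injective toF := by
  intro m n h
  ext i
  have := DFunLike.congr_fun h i
  simpa [toF] using this

theorem Mo_eq (c : Module.Basis (Fin 4) ℂ V) (m : TT) :
    Mo c m = Qc c (MvPolynomial.monomial (toF m) 1) := by
  simp [Mo, Qc, MvPolynomial.aeval_monomial, toF, Finsupp.prod_fintype]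

theorem Mo_indep (c : Module.Basis (Fin 4) ℂ V) : LinearIndependent ℂ (Mo c) := by
  have h1 := ((MvPolynomial.basisMonomials (Fin 4) ℂ).linearIndependent.comp _ toF_inj).map'
    (Qc c).toLinearMap (LinearMap.ker_eq_bot.2 (Qc_inj c))
  have h2 : Mo c = (Qc c).toLinearMap ∘ (MvPolynomial.basisMonomials (Fin 4) ℂ) ∘ toF := by
    funext m
    simp [Mo_eq]
  rw [h2]
  exact h1

theorem symPow_eq_pow (c : Module.Basis (Fin 4) ℂ V) :
    symPow V 5 = (MvPolynomial.homogeneousSubmodule (Fin 4) ℂ 5).map (Qc c).toLinearMap := by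
  have hL : (MvPolynomial.homogeneousSubmodule (Fin 4) ℂ 1).map (Qc c).toLinearMap =
      Submodule.span ℂ (Set.range (Xc c)) := by
    rw [MvPolynomial.homogeneousSubmodule_one_eq_span_X, Submodule.map_span, ← Set.range_comp]
    congr 2
    funext i
    simp [Qc]
  rw [← MvPolynomial.homogeneousSubmodule_one_pow, Submodule.map_pow, hL]
  apply le_antisymm
  · rw [symPow, Submodule.span_le]
    rintro _ ⟨v, rfl⟩
    have hv : ∀ v : V, (fun φ : Module.Dual ℂ V => φ v) ∈ Submodule.span ℂ (Set.range (Xc c)) := by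
      intro v
      have : (fun φ : Module.Dual ℂ V => φ v) = ∑ i, c.repr v i • Xc c i := by
        funext φ
        have h := congrArg φ (c.sum_repr v)
        rw [map_sum] at h
        rw [← h, Finset.sum_apply]
        refine Finset.sum_congr rfl fun i _ => ?_
        rw [map_smul]; rfl
      rw [this]
      exact Submodule.sum_mem _ fun i _ => Submodule.smul_mem _ _ (Submodule.subset_span ⟨i, rfl⟩)
    have : (fun φ : Module.Dual ℂ V => ∏ i, φ (v i)) =
        (fun φ : Module.Dual ℂ V => φ (v 0)) * (fun φ => φ (v 1)) * (fun φ => φ (v 2)) *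
          (fun φ => φ (v 3)) * (fun φ => φ (v 4)) := by
      funext φ
      simp [Fin.prod_univ_five]
    rw [this]
    simp only [pow_succ, pow_zero, one_mul]
    exact Submodule.mul_mem_mul (Submodule.mul_mem_mul (Submodule.mul_mem_mul
      (Submodule.mul_mem_mul (hv _) (hv _)) (hv _)) (hv _)) (hv _)
  · rw [Submodule.span_pow, symPow, Submodule.span_le]
    intro f hf
    obtain ⟨g, rfl⟩ := Set.mem_pow.1 hf
    choose k hk using fun i => (g i).2
    apply Submodule.subset_span
    refine ⟨fun i => c (k i), ?_⟩
    rw [List.prod_ofFn]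
    funext φ
    rw [Finset.prod_apply]
    refine Finset.prod_congr rfl fun i _ => ?_
    rw [← hk]; rfl

theorem symPow_eq_span (c : Module.Basis (Fin 4) ℂ V) :
    symPow V 5 = Submodule.span ℂ (Set.range (Mo c)) := by
  rw [symPow_eq_pow c]
  apply le_antisymm
  · rintro _ ⟨p, hp, rfl⟩
    have hp' : p.IsHomogeneous 5 := hp
    rw [p.as_sum, map_sum]
    refine Submodule.sum_mem _ fun m hm => ?_
    have hd : ∑ i, m i = 5 := by
      have := hp' (MvPolynomial.mem_support_iff.1 hm)
      rw [Finsupp.weight_apply, Finsupp.sum_fintype _ _ (by simp)] at this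
      simpa using this
    have hlt : ∀ i, m i < 6 := fun i => by
      have := Finset.single_le_sum (f := fun i => m i) (fun _ _ => Nat.zero_le _) (Finset.mem_univ i)
      omega
    let m' : TT := ⟨fun i => ⟨m i, hlt i⟩, by simpa using hd⟩
    have hm' : toF m' = m := by ext i; simp [toF, m']
    have : (Qc c).toLinearMap (MvPolynomial.monomial m (MvPolynomial.coeff m p)) =
        MvPolynomial.coeff m p • Mo c m' := by
      rw [Mo_eq, hm', ← map_smul, MvPolynomial.smul_monomial, smul_eq_mul, mul_one]; rfl
    rw [this]
    exact Submodule.smul_mem _ _ (Submodule.subset_span ⟨m', rfl⟩)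
  · rw [Submodule.span_le]
    rintro _ ⟨m, rfl⟩
    refine ⟨MvPolynomial.monomial (toF m) 1, ?_, (Mo_eq c m).symm⟩
    apply MvPolynomial.isHomogeneous_monomial
    rw [Finsupp.degree_eq_sum]
    simpa [toF] using m.2

theorem finrank_symPow (c : Module.Basis (Fin 4) ℂ V) : Module.finrank ℂ (symPow V 5) = 56 := by
  rw [symPow_eq_span c, finrank_span_eq_card (Mo_indep c), card_TT]

theorem symPow_le_of (c : Module.Basis (Fin 4) ℂ V) {U : Submodule ℂ (FF V)}
    (h : ∀ a b d e : ℕ, a + b + d + e = 5 → mn (Xc c 0) (Xc c 1) (Xc c 2) (Xc c 3) a b d e ∈ U) :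
    symPow V 5 ≤ U := by
  rw [symPow_eq_span c, Submodule.span_le]
  rintro _ ⟨m, rfl⟩
  have := h (m.1 0) (m.1 1) (m.1 2) (m.1 3) (by simpa [Fin.sum_univ_four] using m.2)
  rw [Mo, Fin.prod_univ_four]
  exact this

theorem mn_mem_symPow (c : Module.Basis (Fin 4) ℂ V) (a b d e : ℕ) (h : a + b + d + e = 5) :
    mn (Xc c 0) (Xc c 1) (Xc c 2) (Xc c 3) a b d e ∈ symPow V 5 := by
  rw [symPow_eq_span c]
  refine Submodule.subset_span ⟨⟨![⟨a, by omega⟩, ⟨b, by omega⟩, ⟨d, by omega⟩, ⟨e, by omega⟩], ?_⟩, ?_⟩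
  · simpa [Fin.sum_univ_four] using h
  · rw [Mo, Fin.prod_univ_four]; rfl

theorem symPow_subrep (ρ : Representation ℂ Sp4F3 V) : IsSubrep ρ (symPow V 5) := by
  intro g f hf
  have : symPow V 5 ≤ (symPow V 5).comap (symAlg ρ g).toLinearMap := by
    conv_lhs => rw [symPow]
    rw [Submodule.span_le]
    rintro _ ⟨v, rfl⟩
    exact Submodule.subset_span ⟨fun i => ρ g (v i), rfl⟩
  exact this hf

end SymBasis

section Irred

variable {V : Type} [AddCommGroup V] [Module ℂ V]

theorem symAct_mul (ρ : Representation ℂ Sp4F3 V) (g h : Sp4F3) (f : FF V) :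
    symAct ρ (g * h) f = symAct ρ g (symAct ρ h f) := by
  funext φ
  simp only [symAct, map_mul]
  rfl

theorem symAct_one (ρ : Representation ℂ Sp4F3 V) (f : FF V) : symAct ρ 1 f = f := by
  funext φ
  simp only [symAct, map_one]
  rfl

noncomputable def symRep (ρ : Representation ℂ Sp4F3 V) : Representation ℂ Sp4F3 (FF V) where
  toFun g := (symAlg ρ g).toLinearMap
  map_one' := by ext1 f; exact symAct_one ρ f
  map_mul' g h := by ext1 f; exact symAct_mul ρ g h f

/-- span of an orbit -/
noncomputable def orb (ρ : Representation ℂ Sp4F3 V) (v : FF V) : Submodule ℂ (FF V) :=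
  Submodule.span ℂ (Set.range fun g => symAct ρ g v)

theorem orb_subrep (ρ : Representation ℂ Sp4F3 V) (v : FF V) : IsSubrep ρ (orb ρ v) := by
  intro g f hf
  have : orb ρ v ≤ (orb ρ v).comap (symAlg ρ g).toLinearMap := by
    conv_lhs => rw [orb]
    rw [Submodule.span_le]
    rintro _ ⟨h, rfl⟩
    exact Submodule.subset_span ⟨g * h, symAct_mul ρ g h v⟩
  exact this hf

theorem mem_orb (ρ : Representation ℂ Sp4F3 V) (v : FF V) : v ∈ orb ρ v :=
  Submodule.subset_span ⟨1, symAct_one ρ v⟩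

theorem orb_le (ρ : Representation ℂ Sp4F3 V) {v : FF V} {W : Submodule ℂ (FF V)} (hW : IsSubrep ρ W)
    (hv : v ∈ W) : orb ρ v ≤ W := by
  rw [orb, Submodule.span_le]
  rintro _ ⟨h, rfl⟩
  exact hW h v hv

theorem exists_compl (ρ : Representation ℂ Sp4F3 V) {U : Submodule ℂ (FF V)} (hU : IsSubrep ρ U) :
    ∃ U', IsSubrep ρ U' ∧ U ⊓ U' = ⊥ ∧ U ⊔ U' = ⊤ := by
  obtain ⟨C, hC⟩ := exists_isCompl (⟨U, fun g v hv => hU g v hv⟩ : Subrepresentation (symRep ρ))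
  refine ⟨C.toSubmodule, fun g v hv => C.apply_mem_toSubmodule g hv, ?_, ?_⟩
  · have := congrArg Subrepresentation.toSubmodule hC.inf_eq_bot
    exact this
  · have := congrArg Subrepresentation.toSubmodule hC.sup_eq_top
    exact this

theorem orb_irred (ρ : Representation ℂ Sp4F3 V) {v : FF V} (hv : v ≠ 0) {S : Submodule ℂ (FF V)}
    (hS : IsSubrep ρ S) (hvS : v ∈ S) (π : FF V →ₗ[ℂ] FF V) (hπ : Pres ρ π) (hπv : π v = v)
    (hline : ∀ f ∈ S, ∃ t : ℂ, π f = t • v) : IsIrredSubrep ρ (orb ρ v) := by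
  refine ⟨orb_subrep ρ v, fun h => hv ?_, ?_⟩
  · have := mem_orb ρ v
    rw [h] at this
    simpa using this
  intro U hUW hU
  by_cases hvU : v ∈ U
  · right
    exact le_antisymm hUW (orb_le ρ hU hvU)
  left
  have hUS : U ≤ S := hUW.trans (orb_le ρ hS hvS)
  have hU0 : ∀ f ∈ U, π f = 0 := by
    intro f hf
    obtain ⟨t, ht⟩ := hline f (hUS hf)
    by_cases h0 : t = 0
    · rw [ht, h0, zero_smul]
    · exfalso
      apply hvU
      have := hπ U hU f hf
      rw [ht] at this
      exact (U.smul_mem_iff h0).1 this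
  obtain ⟨U', hU', hinf, hsup⟩ := exists_compl ρ hU
  have : v ∈ U ⊔ U' := by rw [hsup]; trivial
  obtain ⟨a, ha, b, hb, hab⟩ := Submodule.mem_sup.1 this
  have hvb : v = π b := by
    conv_lhs => rw [← hπv, ← hab, map_add, hU0 a ha, zero_add]
  have hvU' : v ∈ U' := by rw [hvb]; exact hπ U' hU' b hb
  rw [eq_bot_iff, ← hinf]
  exact le_inf le_rfl (hUW.trans (orb_le ρ hU' hvU'))

end Irred


/-! ### Part 7: spanning -/

section Spanning

variable {V : Type} [AddCommGroup V] [Module ℂ V]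

theorem lc4 {U : Submodule ℂ (FF V)} {a b c d f : FF V} (ha : a ∈ U) (hb : b ∈ U) (hc : c ∈ U) (hd : d ∈ U)
    (p q r s : ℂ) (h : f = p • a + q • b + r • c + s • d) : f ∈ U := by
  rw [h]
  exact U.add_mem (U.add_mem (U.add_mem (U.smul_mem _ ha) (U.smul_mem _ hb)) (U.smul_mem _ hc))
    (U.smul_mem _ hd)

theorem me_pos {U : Submodule ℂ (FF V)} {f g : FF V} (h : f ∈ U) (e : g = f) : g ∈ U := e ▸ h

theorem me_neg {U : Submodule ℂ (FF V)} {f g : FF V} (h : f ∈ U) (e : g = -f) : g ∈ U :=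
  e ▸ U.neg_mem h

theorem blockA {U : Submodule ℂ (FF V)} {p a b c : FF V}
    (h0 : p ^ 2 * (p ^ 3 + a ^ 3 + b ^ 3) ∈ U)
    (h1 : p ^ 2 * (p ^ 3 - b ^ 3 + c ^ 3) ∈ U)
    (h2 : p ^ 2 * (p ^ 3 - a ^ 3 - c ^ 3) ∈ U)
    (h3 : p ^ 2 * (a ^ 3 - b ^ 3 - c ^ 3) ∈ U) :
    p ^ 2 * p ^ 3 ∈ U ∧ p ^ 2 * a ^ 3 ∈ U ∧ p ^ 2 * b ^ 3 ∈ U ∧ p ^ 2 * c ^ 3 ∈ U := by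
  refine ⟨?_, ?_, ?_, ?_⟩
  · refine lc4 h0 h1 h2 h3 (1/3) (1/3) (1/3) (0) ?_
    funext φ
    simp only [Pi.add_apply, Pi.sub_apply, Pi.smul_apply, Pi.mul_apply, Pi.pow_apply, Pi.ofNat_apply, smul_eq_mul]
    ring
  · refine lc4 h0 h1 h2 h3 (1/3) (0) (-1/3) (1/3) ?_
    funext φ
    simp only [Pi.add_apply, Pi.sub_apply, Pi.smul_apply, Pi.mul_apply, Pi.pow_apply, Pi.ofNat_apply, smul_eq_mul]
    ring
  · refine lc4 h0 h1 h2 h3 (1/3) (-1/3) (0) (-1/3) ?_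
    funext φ
    simp only [Pi.add_apply, Pi.sub_apply, Pi.smul_apply, Pi.mul_apply, Pi.pow_apply, Pi.ofNat_apply, smul_eq_mul]
    ring
  · refine lc4 h0 h1 h2 h3 (0) (1/3) (-1/3) (-1/3) ?_
    funext φ
    simp only [Pi.add_apply, Pi.sub_apply, Pi.smul_apply, Pi.mul_apply, Pi.pow_apply, Pi.ofNat_apply, smul_eq_mul]
    ring

theorem blockB {U : Submodule ℂ (FF V)} {p q r s : FF V}
    (h0 : p * q * (p ^ 3 + q ^ 3 + 4 * r ^ 3) ∈ U)
    (h1 : p * q * (p ^ 3 - q ^ 3 + 4 * s ^ 3) ∈ U)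
    (h2 : p * q * (q ^ 3 - r ^ 3 + s ^ 3) ∈ U)
    (h3 : p * q * (p ^ 3 - r ^ 3 - s ^ 3) ∈ U) :
    p * q * p ^ 3 ∈ U ∧ p * q * q ^ 3 ∈ U ∧ p * q * r ^ 3 ∈ U ∧ p * q * s ^ 3 ∈ U := by
  refine ⟨?_, ?_, ?_, ?_⟩
  · refine lc4 h0 h1 h2 h3 (1/6) (1/6) (0) (2/3) ?_
    funext φ
    simp only [Pi.add_apply, Pi.sub_apply, Pi.smul_apply, Pi.mul_apply, Pi.pow_apply, Pi.ofNat_apply, smul_eq_mul]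
    ring
  · refine lc4 h0 h1 h2 h3 (1/6) (-1/6) (2/3) (0) ?_
    funext φ
    simp only [Pi.add_apply, Pi.sub_apply, Pi.smul_apply, Pi.mul_apply, Pi.pow_apply, Pi.ofNat_apply, smul_eq_mul]
    ring
  · refine lc4 h0 h1 h2 h3 (1/6) (0) (-1/6) (-1/6) ?_
    funext φ
    simp only [Pi.add_apply, Pi.sub_apply, Pi.smul_apply, Pi.mul_apply, Pi.pow_apply, Pi.ofNat_apply, smul_eq_mul]
    ring
  · refine lc4 h0 h1 h2 h3 (0) (1/6) (1/6) (-1/6) ?_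
    funext φ
    simp only [Pi.add_apply, Pi.sub_apply, Pi.smul_apply, Pi.mul_apply, Pi.pow_apply, Pi.ofNat_apply, smul_eq_mul]
    ring


theorem span_all {U : Submodule ℂ (FF V)} {x y z w : FF V}
    (a0 : ∀ i, fr1 y (-z) w x i ∈ U) (a1 : ∀ i, fr1 x (-z) (-w) y i ∈ U)
    (a2 : ∀ i, fr1 x (-y) w z i ∈ U) (a3 : ∀ i, fr1 x y z w i ∈ U)
    (b0 : ∀ i, fr2 y (-z) w i ∈ U) (b1 : ∀ i, fr2 x (-z) (-w) i ∈ U)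
    (b2 : ∀ i, fr2 x (-y) w i ∈ U) (b3 : ∀ i, fr2 x y z i ∈ U)
    (a b d e : ℕ) (hs : a + b + d + e = 5) : mn x y z w a b d e ∈ U := by
  have A0 := blockA (U := U) (p := x) (a := y) (b := z) (c := -w)
    (me_pos (b3 3) (by simp [fr1, fr2]; try ring))
    (me_pos (b1 3) (by simp [fr1, fr2]; try ring))
    (me_pos (b2 3) (by simp [fr1, fr2]; try ring))
    (me_pos (a0 1) (by simp [fr1, fr2]; try ring))
  have A1 := blockA (U := U) (p := y) (a := x) (b := z) (c := w)
    (me_pos (b3 4) (by simp [fr1, fr2]; try ring))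
    (me_pos (b0 3) (by simp [fr1, fr2]; try ring))
    (me_neg (b2 4) (by simp [fr1, fr2]; try ring))
    (me_pos (a1 1) (by simp [fr1, fr2]; try ring))
  have A2 := blockA (U := U) (p := z) (a := x) (b := y) (c := -w)
    (me_pos (b3 5) (by simp [fr1, fr2]; try ring))
    (me_neg (b0 4) (by simp [fr1, fr2]; try ring))
    (me_neg (b1 4) (by simp [fr1, fr2]; try ring))
    (me_pos (a2 1) (by simp [fr1, fr2]; try ring))
  have A3 := blockA (U := U) (p := w) (a := y) (b := -z) (c := -x)
    (me_pos (b0 5) (by simp [fr1, fr2]; try ring))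
    (me_neg (b1 5) (by simp [fr1, fr2]; try ring))
    (me_pos (b2 5) (by simp [fr1, fr2]; try ring))
    (me_pos (a3 1) (by simp [fr1, fr2]; try ring))
  have B01 := blockB (U := U) (p := x) (q := y) (r := z) (s := w)
    (me_pos (b3 6) (by simp [fr1, fr2]; try ring))
    (me_neg (b2 6) (by simp [fr1, fr2]; try ring))
    (me_pos (a0 2) (by simp [fr1, fr2]; try ring))
    (me_pos (a1 2) (by simp [fr1, fr2]; try ring))
  have B02 := blockB (U := U) (p := x) (q := z) (r := y) (s := -w)
    (me_pos (b3 8) (by simp [fr1, fr2]; try ring))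
    (me_neg (b1 6) (by simp [fr1, fr2]; try ring))
    (me_pos (a0 3) (by simp [fr1, fr2]; try ring))
    (me_pos (a2 2) (by simp [fr1, fr2]; try ring))
  have B12 := blockB (U := U) (p := y) (q := z) (r := x) (s := w)
    (me_pos (b3 7) (by simp [fr1, fr2]; try ring))
    (me_neg (b0 6) (by simp [fr1, fr2]; try ring))
    (me_pos (a1 3) (by simp [fr1, fr2]; try ring))
    (me_pos (a2 3) (by simp [fr1, fr2]; try ring))
  have B03 := blockB (U := U) (p := x) (q := w) (r := -y) (s := -z)
    (me_pos (b2 8) (by simp [fr1, fr2]; try ring))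
    (me_neg (b1 8) (by simp [fr1, fr2]; try ring))
    (me_pos (a0 4) (by simp [fr1, fr2]; try ring))
    (me_pos (a3 2) (by simp [fr1, fr2]; try ring))
  have B13 := blockB (U := U) (p := y) (q := w) (r := -z) (s := -x)
    (me_pos (b0 8) (by simp [fr1, fr2]; try ring))
    (me_pos (b2 7) (by simp [fr1, fr2]; try ring))
    (me_pos (a1 4) (by simp [fr1, fr2]; try ring))
    (me_pos (a3 3) (by simp [fr1, fr2]; try ring))
  have B23 := blockB (U := U) (p := z) (q := w) (r := -x) (s := -y)
    (me_neg (b1 7) (by simp [fr1, fr2]; try ring))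
    (me_pos (b0 7) (by simp [fr1, fr2]; try ring))
    (me_pos (a2 4) (by simp [fr1, fr2]; try ring))
    (me_pos (a3 4) (by simp [fr1, fr2]; try ring))
  obtain rfl : e = 5 - a - b - d := by omega
  have ha : a ≤ 5 := by omega
  have hb : b ≤ 5 - a := by omega
  have hd : d ≤ 5 - a - b := by omega
  clear hs
  interval_cases a
  · interval_cases b
    · interval_cases d
      · exact me_pos (A3.1) (by simp [mn, fr1, fr2]; try ring)
      · exact me_pos (B23.2.1) (by simp [mn, fr1, fr2]; try ring)
      · exact me_neg (A2.2.2.2) (by simp [mn, fr1, fr2]; try ring)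
      · exact me_neg (A3.2.2.1) (by simp [mn, fr1, fr2]; try ring)
      · exact me_pos (B23.1) (by simp [mn, fr1, fr2]; try ring)
      · exact me_pos (A2.1) (by simp [mn, fr1, fr2]; try ring)
    · interval_cases d
      · exact me_pos (B13.2.1) (by simp [mn, fr1, fr2]; try ring)
      · exact me_pos (B12.2.2.2) (by simp [mn, fr1, fr2]; try ring)
      · exact me_pos (b0 1) (by simp [mn, fr1, fr2]; try ring)
      · exact me_neg (B13.2.2.1) (by simp [mn, fr1, fr2]; try ring)
      · exact me_pos (B12.2.1) (by simp [mn, fr1, fr2]; try ring)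
    · interval_cases d
      · exact me_pos (A1.2.2.2) (by simp [mn, fr1, fr2]; try ring)
      · exact me_neg (b0 2) (by simp [mn, fr1, fr2]; try ring)
      · exact me_pos (b0 0) (by simp [mn, fr1, fr2]; try ring)
      · exact me_pos (A1.2.2.1) (by simp [mn, fr1, fr2]; try ring)
    · interval_cases d
      · exact me_pos (A3.2.1) (by simp [mn, fr1, fr2]; try ring)
      · exact me_neg (B23.2.2.2) (by simp [mn, fr1, fr2]; try ring)
      · exact me_pos (A2.2.2.1) (by simp [mn, fr1, fr2]; try ring)
    · interval_cases d
      · exact me_pos (B13.1) (by simp [mn, fr1, fr2]; try ring)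
      · exact me_pos (B12.1) (by simp [mn, fr1, fr2]; try ring)
    · interval_cases d
      · exact me_pos (A1.1) (by simp [mn, fr1, fr2]; try ring)
  · interval_cases b
    · interval_cases d
      · exact me_pos (B03.2.1) (by simp [mn, fr1, fr2]; try ring)
      · exact me_neg (B02.2.2.2) (by simp [mn, fr1, fr2]; try ring)
      · exact me_pos (b1 1) (by simp [mn, fr1, fr2]; try ring)
      · exact me_neg (B03.2.2.2) (by simp [mn, fr1, fr2]; try ring)
      · exact me_pos (B02.2.1) (by simp [mn, fr1, fr2]; try ring)
    · interval_cases d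
      · exact me_pos (B01.2.2.2) (by simp [mn, fr1, fr2]; try ring)
      · exact me_pos (a3 0) (by simp [mn, fr1, fr2]; try ring)
      · exact me_neg (a2 0) (by simp [mn, fr1, fr2]; try ring)
      · exact me_pos (B01.2.2.1) (by simp [mn, fr1, fr2]; try ring)
    · interval_cases d
      · exact me_pos (b2 1) (by simp [mn, fr1, fr2]; try ring)
      · exact me_pos (a1 0) (by simp [mn, fr1, fr2]; try ring)
      · exact me_pos (b3 1) (by simp [mn, fr1, fr2]; try ring)
    · interval_cases d
      · exact me_neg (B03.2.2.1) (by simp [mn, fr1, fr2]; try ring)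
      · exact me_pos (B02.2.2.1) (by simp [mn, fr1, fr2]; try ring)
    · interval_cases d
      · exact me_pos (B01.2.1) (by simp [mn, fr1, fr2]; try ring)
  · interval_cases b
    · interval_cases d
      · exact me_neg (A0.2.2.2) (by simp [mn, fr1, fr2]; try ring)
      · exact me_neg (b1 2) (by simp [mn, fr1, fr2]; try ring)
      · exact me_neg (b1 0) (by simp [mn, fr1, fr2]; try ring)
      · exact me_pos (A0.2.2.1) (by simp [mn, fr1, fr2]; try ring)
    · interval_cases d
      · exact me_neg (b2 2) (by simp [mn, fr1, fr2]; try ring)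
      · exact me_neg (a0 0) (by simp [mn, fr1, fr2]; try ring)
      · exact me_pos (b3 2) (by simp [mn, fr1, fr2]; try ring)
    · interval_cases d
      · exact me_pos (b2 0) (by simp [mn, fr1, fr2]; try ring)
      · exact me_pos (b3 0) (by simp [mn, fr1, fr2]; try ring)
    · interval_cases d
      · exact me_pos (A0.2.1) (by simp [mn, fr1, fr2]; try ring)
  · interval_cases b
    · interval_cases d
      · exact me_neg (A3.2.2.2) (by simp [mn, fr1, fr2]; try ring)
      · exact me_neg (B23.2.2.1) (by simp [mn, fr1, fr2]; try ring)
      · exact me_pos (A2.2.1) (by simp [mn, fr1, fr2]; try ring)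
    · interval_cases d
      · exact me_neg (B13.2.2.2) (by simp [mn, fr1, fr2]; try ring)
      · exact me_pos (B12.2.2.1) (by simp [mn, fr1, fr2]; try ring)
    · interval_cases d
      · exact me_pos (A1.2.1) (by simp [mn, fr1, fr2]; try ring)
  · interval_cases b
    · interval_cases d
      · exact me_pos (B03.1) (by simp [mn, fr1, fr2]; try ring)
      · exact me_pos (B02.1) (by simp [mn, fr1, fr2]; try ring)
    · interval_cases d
      · exact me_pos (B01.1) (by simp [mn, fr1, fr2]; try ring)
  · interval_cases b
    · interval_cases d
      · exact me_pos (A0.1) (by simp [mn, fr1, fr2]; try ring)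

end Spanning


/-! ### Part 8: assembly -/

section Assembly

variable {V : Type} [AddCommGroup V] [Module ℂ V]

theorem symAlg_pres (ρ : Representation ℂ Sp4F3 V) (g : Sp4F3) : Pres ρ (symAlg ρ g) :=
  fun _ hW f hf => hW g f hf

theorem all_frames (ρ : Representation ℂ Sp4F3 V) {ω : ℂ} (c : Module.Basis (Fin 4) ℂ V)
    (hT : ∀ i j, ρ (gT i) (c j) = (if i = j then 1 else ω) • c j)
    (hR : ∀ i k, ρ (gR i) (c k) = ω • c k + ((1 - ω) / 3 * sg i k) • ∑ l, sg i l • c l) :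
    IsFrame ρ ω (Xc c 1) (-Xc c 2) (Xc c 3) (Xc c 0) ∧
    IsFrame ρ ω (Xc c 0) (-Xc c 2) (-Xc c 3) (Xc c 1) ∧
    IsFrame ρ ω (Xc c 0) (-Xc c 1) (Xc c 3) (Xc c 2) ∧
    IsFrame ρ ω (Xc c 0) (Xc c 1) (Xc c 2) (Xc c 3) := by
  have hX : ∀ g i φ, symAlg ρ g (Xc c i) φ = φ (ρ g (c i)) := fun g i φ => rfl
  have hT1 : ∀ i, symAlg ρ (gT i) (Xc c i) = Xc c i := by
    intro i
    funext φ
    rw [hX, hT, if_pos rfl, one_smul]; rfl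
  have hT2 : ∀ i j, i ≠ j → symAlg ρ (gT i) (Xc c j) = ω • Xc c j := by
    intro i j h
    funext φ
    rw [hX, hT, if_neg h, map_smul]; rfl
  have hR' : ∀ i k, symAlg ρ (gR i) (Xc c k) =
      ω • Xc c k + ((1 - ω) / 3 * sg i k) • ∑ l, sg i l • Xc c l := by
    intro i k
    funext φ
    rw [hX, hR, map_add, map_smul, map_smul, map_sum]
    simp only [map_smul, Pi.add_apply, Pi.smul_apply, Finset.sum_apply]
    rfl
  have P := symAlg_pres ρ
  refine ⟨⟨⟨_, P (gT 1), ?_⟩, ⟨_, P (gT 2), ?_⟩, ⟨_, P (gT 3), ?_⟩, ⟨_, P (gT 0), ?_⟩, ⟨_, P (gR 0), ?_⟩⟩,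
    ⟨⟨_, P (gT 0), ?_⟩, ⟨_, P (gT 2), ?_⟩, ⟨_, P (gT 3), ?_⟩, ⟨_, P (gT 1), ?_⟩, ⟨_, P (gR 1), ?_⟩⟩,
    ⟨⟨_, P (gT 0), ?_⟩, ⟨_, P (gT 1), ?_⟩, ⟨_, P (gT 3), ?_⟩, ⟨_, P (gT 2), ?_⟩, ⟨_, P (gR 2), ?_⟩⟩,
    ⟨⟨_, P (gT 0), ?_⟩, ⟨_, P (gT 1), ?_⟩, ⟨_, P (gT 2), ?_⟩, ⟨_, P (gT 3), ?_⟩, ⟨_, P (gR 3), ?_⟩⟩⟩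
  all_goals
    first
    | (refine ⟨?_, ?_, ?_, ?_⟩ <;> (simp [hT1, hT2]; done))
    | (simp only [map_neg, hR', Fin.sum_univ_four]
       refine ⟨?_, ?_, ?_, ?_⟩ <;> (funext φ; simp [sg]; try ring))

theorem gen1 {ρ : Representation ℂ Sp4F3 V} {ω : ℂ} (hω : ω ^ 2 + ω + 1 = 0) {x y z w : FF V}
    (F0 : IsFrame ρ ω y (-z) w x) (F1 : IsFrame ρ ω x (-z) (-w) y)
    (F2 : IsFrame ρ ω x (-y) w z) (F3 : IsFrame ρ ω x y z w)
    {W : Submodule ℂ (FF V)} (hW : IsSubrep ρ W) (hm : x ^ 2 * y * z * w ∈ W) :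
    (∀ i, fr1 y (-z) w x i ∈ W) ∧ (∀ i, fr1 x (-z) (-w) y i ∈ W) ∧
    (∀ i, fr1 x (-y) w z i ∈ W) ∧ (∀ i, fr1 x y z w i ∈ W) := by
  have e1 := (F3.k211 hω hW hm).1
  have e2 := (F3.rot.rot.swap.k211 hω hW (me_pos hm (by ring))).1
  have e3 := (F0.rot.rot.swap.k211 hω hW (me_neg e1 (by ring))).1
  refine ⟨F0.fr1_mem hω hW ?_ ?_, F1.fr1_mem hω hW ?_ ?_, F2.fr1_mem hω hW ?_ ?_,
    F3.fr1_mem hω hW ?_ ?_⟩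
  · exact me_neg e1 (by ring)
  · exact me_neg hm (by ring)
  · exact me_pos hm (by ring)
  · exact me_pos e1 (by ring)
  · exact me_neg hm (by ring)
  · exact me_neg e2 (by ring)
  · exact hm
  · exact me_neg e3 (by ring)

theorem gen2 {ρ : Representation ℂ Sp4F3 V} {ω : ℂ} (hω : ω ^ 2 + ω + 1 = 0) {x y z w : FF V}
    (F0 : IsFrame ρ ω y (-z) w x) (F1 : IsFrame ρ ω x (-z) (-w) y)
    (F2 : IsFrame ρ ω x (-y) w z) (F3 : IsFrame ρ ω x y z w)
    {W : Submodule ℂ (FF V)} (hW : IsSubrep ρ W) (hm : x ^ 2 * y ^ 2 * z ∈ W) :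
    (∀ i, fr2 y (-z) w i ∈ W) ∧ (∀ i, fr2 x (-z) (-w) i ∈ W) ∧
    (∀ i, fr2 x (-y) w i ∈ W) ∧ (∀ i, fr2 x y z i ∈ W) := by
  have b3 := F3.fr2_mem hω hW hm
  have p1 : y ^ 2 * z ^ 2 * x ∈ W := b3 1
  have p2 : z ^ 2 * x ^ 2 * y ∈ W := b3 2
  have q1 : x ^ 2 * w ^ 2 * z ∈ W := F2.k220 hω hW (me_pos hm (by ring))
  have q2 : y ^ 2 * w ^ 2 * x ∈ W := F0.k220 hω hW (me_pos p1 (by ring))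
  have q3 : (-z) ^ 2 * (-w) ^ 2 * y ∈ W := F1.swap.k220 hω hW (me_pos p2 (by ring))
  refine ⟨F0.fr2_mem hω hW ?_, F1.fr2_mem hω hW ?_, F2.fr2_mem hω hW ?_, b3⟩
  · have h1 := (F0.rot.k221 hω hW (me_pos q3 (by ring))).1
    exact (F0.rot.rot.k221 hω hW h1).1
  · exact (F1.rot.rot.k221 hω hW (me_neg q1 (by ring))).1
  · have h1 := (F2.rot.k221 hω hW (me_pos q2 (by ring))).1
    exact (F2.rot.rot.k221 hω hW h1).1

theorem mn_ne_zero (c : Module.Basis (Fin 4) ℂ V) (a b d e : ℕ) :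
    mn (Xc c 0) (Xc c 1) (Xc c 2) (Xc c 3) a b d e ≠ 0 := by
  intro h
  have := congrFun h (c.constr ℂ fun _ => (1 : ℂ))
  simp [mn, Xc] at this

theorem irr_of_wt {ρ : Representation ℂ Sp4F3 V} {ω : ℂ} (hω : ω ^ 2 + ω + 1 = 0)
    (c : Module.Basis (Fin 4) ℂ V) (F3 : IsFrame ρ ω (Xc c 0) (Xc c 1) (Xc c 2) (Xc c 3))
    (p q r s : ℕ) (hp : p < 3) (hq : q < 3) (hr : r < 3) (hs : s < 3) (h5 : p + q + r + s = 5) :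
    IsIrredSubrep ρ (orb ρ (mn (Xc c 0) (Xc c 1) (Xc c 2) (Xc c 3) p q r s)) := by
  obtain ⟨π, hπ, hv⟩ := F3.wt hω p q r s hp hq hr hs
  refine orb_irred ρ (mn_ne_zero c p q r s) (symPow_subrep ρ) (mn_mem_symPow c p q r s h5) π hπ ?_ ?_
  · rw [hv _ _ _ _ h5, if_pos]
    exact ⟨Nat.mod_eq_of_lt hp, Nat.mod_eq_of_lt hq, Nat.mod_eq_of_lt hr, Nat.mod_eq_of_lt hs⟩
  · have : symPow V 5 ≤ (Submodule.span ℂ {mn (Xc c 0) (Xc c 1) (Xc c 2) (Xc c 3) p q r s}).comap π := by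
      apply symPow_le_of c
      intro a b d e h
      rw [Submodule.mem_comap, hv _ _ _ _ h]
      split_ifs with hh
      · obtain ⟨h1, h2, h3, h4⟩ := hh
        obtain rfl : a = p := by omega
        obtain rfl : b = q := by omega
        obtain rfl : d = r := by omega
        obtain rfl : e = s := by omega
        exact Submodule.mem_span_singleton_self _
      · exact Submodule.zero_mem _
    intro f hf
    obtain ⟨t, ht⟩ := Submodule.mem_span_singleton.1 (this hf)
    exact ⟨t, ht.symm⟩

theorem vanish (ρ : Representation ℂ Sp4F3 V) {ω : ℂ} (hω : ω ^ 2 + ω + 1 = 0)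
    (c : Module.Basis (Fin 4) ℂ V)
    (hT : ∀ i j, ρ (gT i) (c j) = (if i = j then 1 else ω) • c j)
    (hR : ∀ i k, ρ (gR i) (c k) = ω • c k + ((1 - ω) / 3 * sg i k) • ∑ l, sg i l • c l)
    (g : Sp4F3) : ∃ i, c.coord 0 (ρ g (c i)) = 0 := by
  obtain ⟨n0, -, n2, -⟩ := om_ne hω
  have hfix : ∀ v, c.coord 0 (ρ (gT 0) v) = c.coord 0 v := by
    have : c.coord 0 ∘ₗ ρ (gT 0) = c.coord 0 := by
      apply c.ext
      intro j
      rw [LinearMap.comp_apply, hT]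
      by_cases h : 0 = j
      · rw [if_pos h, one_smul]
      · rw [if_neg h, map_smul]
        simp [Ne.symm h]
    intro v
    exact congrArg (fun f => f v) this
  have hz : ∀ t : ℂ, ω * t = t → t = 0 := by
    intro t h
    have : (1 - ω) * t = 0 := by linear_combination -h
    exact (mul_eq_zero.1 this).resolve_left n2
  have hmul : ∀ a b v, ρ (a * b) v = ρ a (ρ b v) := fun a b v => by rw [map_mul]; rfl
  rcases class_cases g⁻¹ with ⟨j, hj⟩ | ⟨i, a, b, d, h⟩
  · have h1 : gT 0 * g = g * gT j := by
      have := congrArg (fun x => g * x * g) hj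
      simpa [mul_assoc] using this
    obtain ⟨k, hk⟩ : ∃ k, j ≠ k := ⟨j + 1, (by decide : ∀ j : Fin 4, j ≠ j + 1) j⟩
    refine ⟨k, hz _ ?_⟩
    have h2 := hfix (ρ g (c k))
    rw [← hmul, h1, hmul, hT, if_neg hk, map_smul, map_smul] at h2
    exact h2
  · set q := gT 0 ^ a * gT 1 ^ b * gT 2 ^ d with hq
    have hpow : ∀ j n, ρ (gT j ^ n) (c i) = ((if j = i then 1 else ω) ^ n) • c i := by
      intro j n
      induction n with
      | zero => simp
      | succ n ih => rw [pow_succ, hmul, hT, map_smul, ih, smul_smul, pow_succ, mul_comm]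
    have hne : ∀ j n, ((if j = i then (1 : ℂ) else ω) ^ n) ≠ 0 := by
      intro j n
      apply pow_ne_zero
      split_ifs
      · exact one_ne_zero
      · exact n0
    obtain ⟨t, ht, hqt⟩ : ∃ t : ℂ, t ≠ 0 ∧ ρ q (c i) = t • c i := by
      refine ⟨_, mul_ne_zero (hne 2 d) (mul_ne_zero (hne 1 b) (hne 0 a)), ?_⟩
      rw [hq, hmul, hmul, hpow, map_smul, map_smul, hpow, map_smul, hpow, smul_smul, smul_smul]
      congr 1; ring
    have h1 : gT 0 * (g * q) = g * q * gR i := by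
      rw [inv_inv] at h
      have := congrArg (fun x => g * x * q) h
      simpa [mul_assoc] using this
    have h0 : sg i i = 0 := by fin_cases i <;> simp [sg]
    have h2 := hfix (ρ (g * q) (c i))
    rw [← hmul, h1, hmul, hR, h0, mul_zero, zero_smul, add_zero, map_smul, map_smul] at h2
    have h3 := hz _ h2
    rw [hmul, hqt, map_smul, map_smul, smul_eq_mul] at h3
    exact ⟨i, (mul_eq_zero.1 h3).resolve_left ht⟩

theorem not_mem_orb (ρ : Representation ℂ Sp4F3 V) {ω : ℂ} (hω : ω ^ 2 + ω + 1 = 0)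
    (c : Module.Basis (Fin 4) ℂ V)
    (hT : ∀ i j, ρ (gT i) (c j) = (if i = j then 1 else ω) • c j)
    (hR : ∀ i k, ρ (gR i) (c k) = ω • c k + ((1 - ω) / 3 * sg i k) • ∑ l, sg i l • c l) :
    mn (Xc c 0) (Xc c 1) (Xc c 2) (Xc c 3) 2 2 1 0 ∉
      orb ρ (mn (Xc c 0) (Xc c 1) (Xc c 2) (Xc c 3) 2 1 1 1) := by
  obtain ⟨n0, n1, n2, -⟩ := om_ne hω
  intro hmem
  have hle : orb ρ (mn (Xc c 0) (Xc c 1) (Xc c 2) (Xc c 3) 2 1 1 1) ≤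
      LinearMap.ker (LinearMap.proj (R := ℂ) (φ := fun _ : Module.Dual ℂ V => ℂ)
        (c.coord 0 ∘ₗ ρ (gR 3))) := by
    rw [orb, Submodule.span_le]
    rintro _ ⟨g, rfl⟩
    obtain ⟨i, hi⟩ := vanish ρ hω c hT hR (gR 3 * g)
    rw [map_mul] at hi
    change c.coord 0 (ρ (gR 3) (ρ g (c i))) = 0 at hi
    change symAct ρ g (mn (Xc c 0) (Xc c 1) (Xc c 2) (Xc c 3) 2 1 1 1) (c.coord 0 ∘ₗ ρ (gR 3)) = 0
    have e : symAct ρ g (mn (Xc c 0) (Xc c 1) (Xc c 2) (Xc c 3) 2 1 1 1) (c.coord 0 ∘ₗ ρ (gR 3)) =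
      c.coord 0 (ρ (gR 3) (ρ g (c 0))) ^ 2 * c.coord 0 (ρ (gR 3) (ρ g (c 1))) ^ 1 *
      c.coord 0 (ρ (gR 3) (ρ g (c 2))) ^ 1 * c.coord 0 (ρ (gR 3) (ρ g (c 3))) ^ 1 := rfl
    rw [e]
    fin_cases i <;> simp only [Fin.zero_eta, Fin.mk_one, Fin.reduceFinMk] at hi <;> rw [hi] <;> ring
  have h1 := hle hmem
  change c.coord 0 (ρ (gR 3) (c 0)) ^ 2 * c.coord 0 (ρ (gR 3) (c 1)) ^ 2 *
    c.coord 0 (ρ (gR 3) (c 2)) ^ 1 * c.coord 0 (ρ (gR 3) (c 3)) ^ 0 = 0 at h1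
  have h3 : ∀ k, c.coord 0 (ρ (gR 3) (c k)) = ω * (if k = 0 then 1 else 0) + (1 - ω) / 3 * sg 3 k := by
    intro k
    rw [hR, map_add, map_smul, map_smul, map_sum, Fin.sum_univ_four]
    simp [sg, Finsupp.single_apply]
  rw [h3, h3, h3] at h1
  simp [sg] at h1
  rcases h1 with h1 | h1
  · apply n1; linear_combination 3 * h1
  · exact n2 h1

theorem finrank_fam {n : ℕ} (u : Fin 4 → Fin n → FF V) :
    Module.finrank ℂ (Submodule.span ℂ (Set.range fun p : Fin 4 × Fin n => u p.1 p.2)) ≤ 4 * n := by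
  have := finrank_range_le_card (R := ℂ) (fun p : Fin 4 × Fin n => u p.1 p.2)
  simpa [Set.finrank] using this

theorem arith_aux {a b d e f g h : ℕ} (r1 : a ≤ 20) (r2 : b ≤ 36) (h56 : h = 56) (s1 : h ≤ d)
    (s2 : d ≤ a + b) (s3 : e + 0 = f + g) (s4 : e ≤ h) (s5 : a ≤ f) (s6 : b ≤ g) :
    f = 20 ∧ g = 36 ∧ e = h := by omega

theorem main_aux (ρ : Representation ℂ Sp4F3 V) [FiniteDimensional ℂ V]
    (hfaithful : Function.Injective ρ) (hdim : Module.finrank ℂ V = 4) :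
    Module.finrank ℂ (symPow V 5) = 56 ∧
    ∃ W₁ W₂ : Submodule ℂ (Module.Dual ℂ V → ℂ),
      W₁ ⊓ W₂ = ⊥ ∧ W₁ ⊔ W₂ = symPow V 5 ∧
      IsIrredSubrep ρ W₁ ∧ Module.finrank ℂ W₁ = 20 ∧
      IsIrredSubrep ρ W₂ ∧ Module.finrank ℂ W₂ = 36 := by
  obtain ⟨ω, hω, c, hT, hR⟩ := exists_normal_form ρ hfaithful hdim
  obtain ⟨F0, F1, F2, F3⟩ := all_frames ρ c hT hR
  have h56 := finrank_symPow c
  refine ⟨h56, ?_⟩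
  set v1 := mn (Xc c 0) (Xc c 1) (Xc c 2) (Xc c 3) 2 1 1 1 with hv1
  set v2 := mn (Xc c 0) (Xc c 1) (Xc c 2) (Xc c 3) 2 2 1 0 with hv2
  have I1 : IsIrredSubrep ρ (orb ρ v1) :=
    irr_of_wt hω c F3 2 1 1 1 (by norm_num) (by norm_num) (by norm_num) (by norm_num) rfl
  have I2 : IsIrredSubrep ρ (orb ρ v2) :=
    irr_of_wt hω c F3 2 2 1 0 (by norm_num) (by norm_num) (by norm_num) (by norm_num) rfl
  have hnot : v2 ∉ orb ρ v1 := not_mem_orb ρ hω c hT hR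
  have hS1 : orb ρ v1 ≤ symPow V 5 := orb_le ρ (symPow_subrep ρ) (mn_mem_symPow c _ _ _ _ rfl)
  have hS2 : orb ρ v2 ≤ symPow V 5 := orb_le ρ (symPow_subrep ρ) (mn_mem_symPow c _ _ _ _ rfl)
  have hm1 : Xc c 0 ^ 2 * Xc c 1 * Xc c 2 * Xc c 3 ∈ orb ρ v1 :=
    me_pos (mem_orb ρ v1) (by simp only [hv1, mn]; ring)
  have hm2 : Xc c 0 ^ 2 * Xc c 1 ^ 2 * Xc c 2 ∈ orb ρ v2 :=
    me_pos (mem_orb ρ v2) (by simp only [hv2, mn]; ring)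
  obtain ⟨a0, a1, a2, a3⟩ := gen1 hω F0 F1 F2 F3 I1.1 hm1
  obtain ⟨b0, b1, b2, b3⟩ := gen2 hω F0 F1 F2 F3 I2.1 hm2
  generalize orb ρ v1 = W1 at *
  generalize hW2 : orb ρ v2 = W2 at *
  have hv2W : v2 ∈ W2 := hW2 ▸ mem_orb ρ v2
  have hinf : W1 ⊓ W2 = ⊥ := by
    have hsub : IsSubrep ρ (W1 ⊓ W2) := fun g f hf => ⟨I1.1 g f hf.1, I2.1 g f hf.2⟩
    rcases I2.2.2 _ inf_le_right hsub with h | h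
    · exact h
    · exfalso
      apply hnot
      rw [← h] at hv2W
      exact hv2W.1
  let u1 : Fin 4 → Fin 5 → FF V := ![fr1 (Xc c 1) (-Xc c 2) (Xc c 3) (Xc c 0),
    fr1 (Xc c 0) (-Xc c 2) (-Xc c 3) (Xc c 1), fr1 (Xc c 0) (-Xc c 1) (Xc c 3) (Xc c 2),
    fr1 (Xc c 0) (Xc c 1) (Xc c 2) (Xc c 3)]
  let u2 : Fin 4 → Fin 9 → FF V := ![fr2 (Xc c 1) (-Xc c 2) (Xc c 3),
    fr2 (Xc c 0) (-Xc c 2) (-Xc c 3), fr2 (Xc c 0) (-Xc c 1) (Xc c 3),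
    fr2 (Xc c 0) (Xc c 1) (Xc c 2)]
  let U1 := Submodule.span ℂ (Set.range fun p : Fin 4 × Fin 5 => u1 p.1 p.2)
  let U2 := Submodule.span ℂ (Set.range fun p : Fin 4 × Fin 9 => u2 p.1 p.2)
  have r1 : Module.finrank ℂ U1 ≤ 20 := finrank_fam u1
  have r2 : Module.finrank ℂ U2 ≤ 36 := finrank_fam u2
  have l1 : U1 ≤ W1 := by
    rw [Submodule.span_le]
    rintro _ ⟨⟨i, j⟩, rfl⟩
    fin_cases i
    exacts [a0 j, a1 j, a2 j, a3 j]
  have l2 : U2 ≤ W2 := by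
    rw [Submodule.span_le]
    rintro _ ⟨⟨i, j⟩, rfl⟩
    fin_cases i
    exacts [b0 j, b1 j, b2 j, b3 j]
  have m1 : ∀ i j, u1 i j ∈ U1 ⊔ U2 := fun i j =>
    Submodule.mem_sup_left (Submodule.subset_span ⟨(i, j), rfl⟩)
  have m2 : ∀ i j, u2 i j ∈ U1 ⊔ U2 := fun i j =>
    Submodule.mem_sup_right (Submodule.subset_span ⟨(i, j), rfl⟩)
  have hspan : symPow V 5 ≤ U1 ⊔ U2 :=
    symPow_le_of c (span_all (m1 0) (m1 1) (m1 2) (m1 3) (m2 0) (m2 1) (m2 2) (m2 3))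
  have fS : FiniteDimensional ℂ (symPow V 5) := Module.finite_of_finrank_pos (by omega)
  have f1 : FiniteDimensional ℂ W1 := Submodule.finiteDimensional_of_le hS1
  have f2 : FiniteDimensional ℂ W2 := Submodule.finiteDimensional_of_le hS2
  have g1 : FiniteDimensional ℂ U1 := Submodule.finiteDimensional_of_le l1
  have g2 : FiniteDimensional ℂ U2 := Submodule.finiteDimensional_of_le l2
  have s1 := Submodule.finrank_mono hspan
  have s2 := Submodule.finrank_add_le_finrank_add_finrank U1 U2
  have s3 := Submodule.finrank_sup_add_finrank_inf_eq W1 W2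
  rw [hinf, finrank_bot] at s3
  have s4 := Submodule.finrank_mono (sup_le hS1 hS2)
  have s5 := Submodule.finrank_mono l1
  have s6 := Submodule.finrank_mono l2
  obtain ⟨k1, k2, k3⟩ := arith_aux r1 r2 h56 s1 s2 s3 s4 s5 s6
  exact ⟨W1, W2, hinf, Submodule.eq_of_le_of_finrank_eq (sup_le hS1 hS2) k3, I1, k1, I2, k2⟩

end Assembly


/-- Let `V` be a faithful irreducible four-dimensional complex representation of the
quasi-simple group `Sp₄(F₃)`.  Then the fifth symmetric power `S⁵V` (of dimension `56`) is a
direct sum of two irreducible representations of `Sp₄(F₃)`, of dimensions `20` and `36`. -/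
theorem symFifth_of_four_dim_faithful_irreducible_Sp4F3
    (V : Type) [AddCommGroup V] [Module ℂ V] [FiniteDimensional ℂ V]
    (ρ : Representation ℂ Sp4F3 V)
    (hfaithful : Function.Injective ρ)
    (hdim : Module.finrank ℂ V = 4)
    (hirr : ∀ W : Submodule ℂ V,
      (∀ g : Sp4F3, ∀ v ∈ W, ρ g v ∈ W) → W = ⊥ ∨ W = ⊤) :
    Module.finrank ℂ (symPow V 5) = 56 ∧
    ∃ W₁ W₂ : Submodule ℂ (Module.Dual ℂ V → ℂ),
      W₁ ⊓ W₂ = ⊥ ∧ W₁ ⊔ W₂ = symPow V 5 ∧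
      IsIrredSubrep ρ W₁ ∧ Module.finrank ℂ W₁ = 20 ∧
      IsIrredSubrep ρ W₂ ∧ Module.finrank ℂ W₂ = 36 := by
  exact main_aux ρ hfaithful hdim
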